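/- arXiv:1803.08499 — 7 statements merged into one kernel-verified Lean document; each statement's English description precedes it below -/
import Mathlib

section
/- Let (X,d,μ) be a geodesic metric measure space and let Ω ⊆ X be a domain. Let 1 ≤ p < p* < ∞ and define Q by 1/p − 1/p* = 1/Q. Suppose the embedding M^{1,p}(Ω) ↪ L^{p*}(Ω) holds, i.e., there is a constant C_e such that ‖u‖_{L^{p*}(Ω)} ≤ C_e ‖u‖_{M^{1,p}(Ω)} for every u ∈ M^{1,p}(Ω). Then there exists a constant b > 0, depending only on p, p* and C_e, such that μ(B(x,R) ∩ Ω) ≥ b R^Q for every x ∈ Ω and every R ∈ (0,1]. -/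
open MeasureTheory Metric Set ENNReal Filter

/-- A metric space is *geodesic* if every pair of points can be joined by a curve whose
length equals the distance between the points (equivalently, an isometrically parametrized
segment). -/
def IsGeodesicSpace (X : Type*) [MetricSpace X] : Prop :=
  ∀ x y : X, ∃ γ : ℝ → X, γ 0 = x ∧ γ (dist x y) = y ∧
    ∀ s ∈ Set.Icc (0 : ℝ) (dist x y), ∀ t ∈ Set.Icc (0 : ℝ) (dist x y),
      dist (γ s) (γ t) = |s - t|

/-- A metric measure space: the (Borel) measure is positive on nonempty open sets and
finite on bounded sets. -/
def IsMetricMeasureSpace {X : Type*} [MetricSpace X] [MeasurableSpace X]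
    (μ : MeasureTheory.Measure X) : Prop :=
  (∀ U : Set X, IsOpen U → U.Nonempty → 0 < μ U) ∧
  (∀ s : Set X, Bornology.IsBounded s → μ s < ⊤)

/-- `g` is a Hajłasz `s`-gradient of `u` on `S`. -/
def IsHajlaszGradient {X : Type*} [MetricSpace X] [MeasurableSpace X]
    (μ : MeasureTheory.Measure X) (s : ℝ) (S : Set X) (u g : X → ℝ) : Prop :=
  Measurable g ∧ (∀ x, 0 ≤ g x) ∧
  ∃ E ⊆ S, μ E = 0 ∧ ∀ x ∈ S \ E, ∀ y ∈ S \ E,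
    |u x - u y| ≤ dist x y ^ s * (g x + g y)

/-- The Hajłasz–Sobolev `M^{s,p}(S)` norm:
`‖u‖_{L^p(S)} + inf {‖g‖_{L^p(S)} : g an s-gradient of u}`. -/
noncomputable def MspNorm {X : Type*} [MetricSpace X] [MeasurableSpace X]
    (μ : MeasureTheory.Measure X) (s p : ℝ) (S : Set X) (u : X → ℝ) : ℝ≥0∞ :=
  eLpNorm u (ENNReal.ofReal p) (μ.restrict S) +
    ⨅ (g : X → ℝ) (_ : IsHajlaszGradient μ s S u g),
      eLpNorm g (ENNReal.ofReal p) (μ.restrict S)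

/-- Membership in the Hajłasz–Sobolev space `M^{s,p}(S)`. -/
def MemMsp {X : Type*} [MetricSpace X] [MeasurableSpace X]
    (μ : MeasureTheory.Measure X) (s p : ℝ) (S : Set X) (u : X → ℝ) : Prop :=
  AEStronglyMeasurable u (μ.restrict S) ∧ MspNorm μ s p S u < ⊤

/-- Telescoping over the radii at which a monotone volume function `V` halves: a weak-type
capacity estimate between concentric balls self-improves to a lower volume bound. -/
theorem le_mul_rpow_of_capacity_estimate {V : ℝ → ℝ} {a c K R : ℝ} (hc : 0 ≤ c) (hac : c < a)
    (hK : 0 ≤ K) (hV : Monotone V) (hpos : ∀ s, 0 < s → 0 < V s) (hR : 0 < R) (hR1 : R ≤ 1)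
    (hcap : ∀ s t, 0 < s → s < t → t ≤ 1 → (t - s) * V s ^ c ≤ K * V t ^ a) :
    R ≤ K * 2 ^ c / (1 - 2⁻¹ ^ (a - c)) * V R ^ (a - c) := by
  set m := V R with hm
  have hm0 : 0 < m := hpos R hR
  set q : ℝ := 2⁻¹ ^ (a - c) with hq
  have hq0 : 0 < q := by positivity
  have hq1 : q < 1 := Real.rpow_lt_one (by norm_num) (by norm_num) (by linarith)
  let S : ℕ → Set ℝ := fun j => insert 0 {s | 0 < s ∧ s ≤ R ∧ V s ≤ 2⁻¹ ^ j * m}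
  let r : ℕ → ℝ := fun j => sSup (S j)
  have hS : ∀ j, ∀ s ∈ S j, s ≤ R := by
    rintro j s (rfl | hs)
    · exact hR.le
    · exact hs.2.1
  have hbdd : ∀ j, BddAbove (S j) := fun j => ⟨R, hS j⟩
  have hne : ∀ j, (S j).Nonempty := fun j => ⟨0, mem_insert _ _⟩
  have hr0 : ∀ j, 0 ≤ r j := fun j => le_csSup (hbdd j) (mem_insert _ _)
  have hrR : ∀ j, r j ≤ R := fun j => csSup_le (hne j) (hS j)
  have hzero : r 0 = R := by
    refine le_antisymm (hrR 0) (le_csSup (hbdd 0) (Or.inr ⟨hR, le_rfl, ?_⟩))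
    simp [hm]
  have hbelow : ∀ j t, 0 < t → t < r j → V t ≤ 2⁻¹ ^ j * m := by
    intro j t ht htr
    obtain ⟨s, hs, hts⟩ := exists_lt_of_lt_csSup (hne j) htr
    rcases hs with rfl | hs
    · exact absurd ht hts.not_gt
    · exact (hV hts.le).trans hs.2.2
  have habove : ∀ j s, r j < s → s ≤ R → 2⁻¹ ^ j * m ≤ V s := by
    intro j s hrs hsR
    by_contra! h
    exact absurd (le_csSup (hbdd j) (Or.inr ⟨(hr0 j).trans_lt hrs, hsR, h.le⟩)) hrs.not_ge
  have hstep : ∀ j, r j - r (j + 1) ≤ K * 2 ^ c * m ^ (a - c) * q ^ j := by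
    intro j
    have hD : 0 ≤ K * 2 ^ c * m ^ (a - c) * q ^ j := by positivity
    by_contra! h
    have hlt : r (j + 1) < r j := by linarith
    obtain ⟨δ, hδ0, hδ⟩ : ∃ δ > 0, K * 2 ^ c * m ^ (a - c) * q ^ j + 2 * δ <
        r j - r (j + 1) := ⟨(r j - r (j + 1) - K * 2 ^ c * m ^ (a - c) * q ^ j) / 4,
      by linarith, by linarith⟩
    have hs0 : 0 < r (j + 1) + δ := by linarith [hr0 (j + 1)]
    have hst : r (j + 1) + δ < r j - δ := by linarith
    have h1 := hcap _ _ hs0 hst (by linarith [hrR j])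
    have h2 : (2⁻¹ ^ (j + 1) * m) ^ c ≤ V (r (j + 1) + δ) ^ c :=
      Real.rpow_le_rpow (by positivity)
        (habove (j + 1) _ (by linarith) (by linarith [hrR j])) hc
    have h3 : V (r j - δ) ^ a ≤ (2⁻¹ ^ j * m) ^ a :=
      Real.rpow_le_rpow (hpos _ (by linarith)).le (hbelow j _ (by linarith) (by linarith))
        (by linarith)
    have h4 : K * (2⁻¹ ^ j * m) ^ a =
        K * 2 ^ c * m ^ (a - c) * q ^ j * (2⁻¹ ^ (j + 1) * m) ^ c := by
      have hA : (0 : ℝ) < 2⁻¹ ^ j * m := by positivity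
      have e1 : m ^ (a - c) * q ^ j = (2⁻¹ ^ j * m) ^ (a - c) := by
        rw [Real.mul_rpow (by positivity) hm0.le, hq, ← Real.rpow_natCast, ← Real.rpow_natCast,
          ← Real.rpow_mul (by positivity), ← Real.rpow_mul (by positivity), mul_comm (a - c),
          mul_comm]
      have e2 : (2 : ℝ) ^ c * (2⁻¹ ^ (j + 1) * m) ^ c = (2⁻¹ ^ j * m) ^ c := by
        rw [← Real.mul_rpow (by positivity) (by positivity)]
        congr 1
        rw [pow_succ]
        ring
      calc K * (2⁻¹ ^ j * m) ^ a
          = K * ((2⁻¹ ^ j * m) ^ (a - c) * (2⁻¹ ^ j * m) ^ c) := by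
            rw [← Real.rpow_add hA, sub_add_cancel]
        _ = _ := by rw [← e1, ← e2]; ring
    have h5 : 0 < (2⁻¹ ^ (j + 1) * m) ^ c := by positivity
    have h6 : (r j - δ - (r (j + 1) + δ)) * (2⁻¹ ^ (j + 1) * m) ^ c ≤
        K * 2 ^ c * m ^ (a - c) * q ^ j * (2⁻¹ ^ (j + 1) * m) ^ c := by
      rw [← h4]
      calc _ ≤ (r j - δ - (r (j + 1) + δ)) * V (r (j + 1) + δ) ^ c :=
            mul_le_mul_of_nonneg_left h2 (by linarith)
        _ ≤ K * V (r j - δ) ^ a := h1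
        _ ≤ _ := mul_le_mul_of_nonneg_left h3 hK
    have h7 := le_of_mul_le_mul_right h6 h5
    linarith
  have hsum : ∀ n, R - r n ≤ K * 2 ^ c * m ^ (a - c) * ∑ j ∈ Finset.range n, q ^ j := by
    intro n
    induction n with
    | zero => simp [hzero]
    | succ n ih =>
      rw [Finset.sum_range_succ, mul_add]
      linarith [hstep n]
  have hgeom : ∀ n, ∑ j ∈ Finset.range n, q ^ j ≤ (1 - q)⁻¹ := fun n => by
    rw [← tsum_geometric_of_lt_one hq0.le hq1]
    exact (summable_geometric_of_lt_one hq0.le hq1).sum_le_tsum _ (fun _ _ => by positivity)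
  refine le_of_forall_pos_le_add fun ε hε => ?_
  obtain ⟨n, hn⟩ := exists_pow_lt_of_lt_one (div_pos (hpos ε hε) hm0)
    (by norm_num : (2⁻¹ : ℝ) < 1)
  have hrn : r n ≤ ε := by
    by_contra! h
    have h1 := hbelow n ε hε h
    rw [lt_div_iff₀ hm0] at hn
    linarith
  have h1 := mul_le_mul_of_nonneg_left (hgeom n)
    (by positivity : 0 ≤ K * 2 ^ c * m ^ (a - c))
  have h2 : K * 2 ^ c / (1 - q) * m ^ (a - c) = K * 2 ^ c * m ^ (a - c) * (1 - q)⁻¹ := by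
    rw [div_eq_mul_inv]
    ring
  rw [h2]
  linarith [hsum n]

/-- The piecewise linear radial cutoff equal to `1` on `closedBall x s` and to `0` outside
`ball x t`. -/
noncomputable def radialCutoff {X : Type*} [MetricSpace X] (x : X) (s t : ℝ) (y : X) : ℝ :=
  max 0 (min 1 ((t - dist y x) / (t - s)))

section RadialCutoff

variable {X : Type*} [MetricSpace X] {x : X} {s t : ℝ}

theorem continuous_radialCutoff : Continuous (radialCutoff x s t) := by
  unfold radialCutoff
  fun_prop

theorem radialCutoff_nonneg (y : X) : 0 ≤ radialCutoff x s t y := le_max_left _ _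

theorem radialCutoff_le_one (y : X) : radialCutoff x s t y ≤ 1 :=
  max_le zero_le_one (min_le_left _ _)

theorem radialCutoff_eq_one (hst : s < t) {y : X} (hy : y ∈ ball x s) :
    radialCutoff x s t y = 1 := by
  have h : 1 ≤ (t - dist y x) / (t - s) := by
    rw [le_div_iff₀ (sub_pos.2 hst)]
    linarith [mem_ball.1 hy]
  rw [radialCutoff, min_eq_left h, max_eq_right zero_le_one]

theorem radialCutoff_eq_zero (hst : s < t) {y : X} (hy : y ∉ ball x t) :
    radialCutoff x s t y = 0 := by
  have h : (t - dist y x) / (t - s) ≤ 0 :=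
    div_nonpos_of_nonpos_of_nonneg (by linarith [not_lt.1 (mt mem_ball.2 hy)])
      (sub_pos.2 hst).le
  exact max_eq_left ((min_le_right _ _).trans h)

theorem abs_radialCutoff_sub_le (hst : s < t) (y z : X) :
    |radialCutoff x s t y - radialCutoff x s t z| ≤ dist y z * (t - s)⁻¹ := by
  have hts : 0 < t - s := sub_pos.2 hst
  unfold radialCutoff
  refine (abs_max_sub_max_le_max _ _ _ _).trans (max_le (by simp; positivity) ?_)
  refine (abs_min_sub_min_le_max _ _ _ _).trans (max_le (by simp; positivity) ?_)
  rw [← sub_div, abs_div, abs_of_pos hts, div_eq_mul_inv]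
  refine mul_le_mul_of_nonneg_right ?_ (by positivity)
  rw [show t - dist y x - (t - dist z x) = dist z x - dist y x by ring, dist_comm y z]
  exact abs_dist_sub_le _ _ _

theorem isHajlaszGradient_radialCutoff [MeasurableSpace X] [BorelSpace X] (μ : Measure X)
    (hst : s < t) (Ω : Set X) :
    IsHajlaszGradient μ 1 Ω (radialCutoff x s t) ((ball x t).indicator fun _ => (t - s)⁻¹) := by
  have hts : 0 < (t - s)⁻¹ := inv_pos.2 (sub_pos.2 hst)
  have hg : ∀ y, 0 ≤ (ball x t).indicator (fun _ => (t - s)⁻¹) y :=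
    fun y => indicator_nonneg (fun _ _ => hts.le) y
  refine ⟨measurable_const.indicator measurableSet_ball, hg, ∅, empty_subset _, measure_empty,
    fun y _ z _ => ?_⟩
  rw [Real.rpow_one]
  by_cases hy : y ∈ ball x t
  · refine (abs_radialCutoff_sub_le hst y z).trans
      (mul_le_mul_of_nonneg_left ?_ dist_nonneg)
    rw [indicator_of_mem hy]
    linarith [hg z]
  by_cases hz : z ∈ ball x t
  · refine (abs_radialCutoff_sub_le hst y z).trans
      (mul_le_mul_of_nonneg_left ?_ dist_nonneg)
    rw [indicator_of_mem hz]
    linarith [hg y]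
  rw [radialCutoff_eq_zero hst hy, radialCutoff_eq_zero hst hz, sub_self, abs_zero]
  exact mul_nonneg dist_nonneg (add_nonneg (hg y) (hg z))

end RadialCutoff

theorem eLpNorm_indicator_ball_const {X : Type*} [MetricSpace X] [MeasurableSpace X]
    [BorelSpace X] (ν : Measure X) (x : X) (t k : ℝ) {p : ℝ} (hp : 0 < p) (hk : 0 ≤ k) :
    eLpNorm ((ball x t).indicator fun _ => k) (ENNReal.ofReal p) ν =
      ENNReal.ofReal k * ν (ball x t) ^ (1 / p) := by
  rw [eLpNorm_indicator_const measurableSet_ball (by simpa using hp) ofReal_ne_top,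
    ENNReal.toReal_ofReal hp.le, Real.enorm_of_nonneg hk]

theorem mspNorm_radialCutoff_le {X : Type*} [MetricSpace X] [MeasurableSpace X]
    [BorelSpace X] (μ : Measure X) (Ω : Set X) (x : X) {s t p : ℝ} (hp : 0 < p) (hst : s < t) :
    MspNorm μ 1 p Ω (radialCutoff x s t) ≤
      ENNReal.ofReal (1 + (t - s)⁻¹) * μ.restrict Ω (ball x t) ^ (1 / p) := by
  have hts : 0 ≤ (t - s)⁻¹ := inv_nonneg.2 (sub_pos.2 hst).le
  rw [ENNReal.ofReal_add zero_le_one hts, add_mul,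
    ← eLpNorm_indicator_ball_const _ x t _ hp zero_le_one,
    ← eLpNorm_indicator_ball_const _ x t _ hp hts]
  refine add_le_add (eLpNorm_mono_real fun y => ?_)
    (iInf₂_le _ (isHajlaszGradient_radialCutoff μ hst Ω))
  rw [Real.norm_of_nonneg (radialCutoff_nonneg y)]
  by_cases hy : y ∈ ball x t
  · rw [indicator_of_mem hy]
    exact radialCutoff_le_one y
  · rw [indicator_of_notMem hy, radialCutoff_eq_zero hst hy]

/-- Testing a Sobolev embedding with radial cutoffs. -/
theorem rpow_measure_ball_le_of_embedding {X : Type*} [MetricSpace X] [MeasurableSpace X]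
    [BorelSpace X] {μ : Measure X} (hμ : ∀ s : Set X, Bornology.IsBounded s → μ s < ⊤)
    {Ω : Set X} {p pstar Ce : ℝ} (hp : 0 < p) (hpstar : 0 < pstar)
    (hemb : ∀ u : X → ℝ, MemMsp μ 1 p Ω u →
      eLpNorm u (ENNReal.ofReal pstar) (μ.restrict Ω) ≤ ENNReal.ofReal Ce * MspNorm μ 1 p Ω u)
    (x : X) {s t : ℝ} (hst : s < t) :
    μ.restrict Ω (ball x s) ^ (1 / pstar) ≤ ENNReal.ofReal Ce *
      (ENNReal.ofReal (1 + (t - s)⁻¹) * μ.restrict Ω (ball x t) ^ (1 / p)) := by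
  have hle := mspNorm_radialCutoff_le μ Ω x hp hst
  have hfin : μ.restrict Ω (ball x t) ≠ ⊤ :=
    ((Measure.restrict_apply_le _ _).trans_lt (hμ _ isBounded_ball)).ne
  have hmem : MemMsp μ 1 p Ω (radialCutoff x s t) := by
    refine ⟨continuous_radialCutoff.measurable.aestronglyMeasurable, hle.trans_lt ?_⟩
    exact ENNReal.mul_lt_top ofReal_lt_top
      (ENNReal.rpow_lt_top_of_nonneg (by positivity) hfin)
  calc μ.restrict Ω (ball x s) ^ (1 / pstar)
      = eLpNorm ((ball x s).indicator fun _ => (1 : ℝ)) (ENNReal.ofReal pstar)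
          (μ.restrict Ω) := by
        rw [eLpNorm_indicator_ball_const _ x s _ hpstar zero_le_one, ofReal_one, one_mul]
    _ ≤ eLpNorm (radialCutoff x s t) (ENNReal.ofReal pstar) (μ.restrict Ω) := by
        refine eLpNorm_mono fun y => ?_
        by_cases hy : y ∈ ball x s
        · rw [indicator_of_mem hy, radialCutoff_eq_one hst hy]
        · rw [indicator_of_notMem hy, norm_zero]
          exact norm_nonneg _
    _ ≤ _ := (hemb _ hmem).trans (by gcongr)

/-- If `(X,d,μ)` is a geodesic metric measure space, `Ω ⊆ X` a domain,
`1 ≤ p < p* < ∞`, `1/p - 1/p* = 1/Q`, and the embedding `M^{1,p}(Ω) ↪ L^{p*}(Ω)` holds with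
constant `C_e`, then there is `b > 0` (depending only on `p`, `p*` and `C_e`) with
`μ(B(x,R) ∩ Ω) ≥ b R^Q` for all `x ∈ Ω` and `R ∈ (0,1]`. -/
theorem sobolev_embedding_implies_measure_density
    (p pstar Q Ce : ℝ) (hp : 1 ≤ p) (hppstar : p < pstar) (hCe : 0 < Ce)
    (hQ : 1 / p - 1 / pstar = 1 / Q) :
    ∃ b : ℝ, 0 < b ∧
      ∀ (X : Type) [MetricSpace X] [MeasurableSpace X] [BorelSpace X]
        (μ : MeasureTheory.Measure X),
        IsMetricMeasureSpace μ → IsGeodesicSpace X →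
        ∀ Ω : Set X, IsOpen Ω → IsConnected Ω →
        (∀ u : X → ℝ, MemMsp μ 1 p Ω u →
          eLpNorm u (ENNReal.ofReal pstar) (μ.restrict Ω) ≤
            ENNReal.ofReal Ce * MspNorm μ 1 p Ω u) →
        ∀ x ∈ Ω, ∀ R : ℝ, 0 < R → R ≤ 1 →
          ENNReal.ofReal (b * R ^ Q) ≤ μ (ball x R ∩ Ω) := by
  have hp0 : 0 < p := by linarith
  have hps0 : 0 < pstar := by linarith
  have hlt : 1 / pstar < 1 / p := one_div_lt_one_div_of_lt hp0 hppstar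
  have hQ0 : 0 < Q := one_div_pos.1 (by linarith)
  have hq1 : (2⁻¹ : ℝ) ^ (1 / p - 1 / pstar) < 1 :=
    Real.rpow_lt_one (by norm_num) (by norm_num) (by linarith)
  set D : ℝ := 2 * Ce * 2 ^ (1 / pstar) / (1 - 2⁻¹ ^ (1 / p - 1 / pstar))
  have hD0 : 0 < D := div_pos (by positivity) (by linarith)
  refine ⟨D⁻¹ ^ Q, by positivity, ?_⟩
  intro X _ _ _ μ hμ _ Ω hΩ _ hemb x hx R hR hR1
  have hfin : ∀ t, μ.restrict Ω (ball x t) ≠ ⊤ := fun t =>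
    ((Measure.restrict_apply_le _ _).trans_lt (hμ.2 _ isBounded_ball)).ne
  have hbound : R ≤ D * (μ.restrict Ω).real (ball x R) ^ (1 / p - 1 / pstar) := by
    refine le_mul_rpow_of_capacity_estimate (V := fun t => (μ.restrict Ω).real (ball x t))
      (by positivity) hlt (by positivity)
      (fun s t hst => measureReal_mono (ball_subset_ball hst) (hfin t)) (fun s hs => ?_)
      hR hR1 (fun s t hs hst ht => ?_)
    · refine ENNReal.toReal_pos ?_ (hfin s)
      rw [Measure.restrict_apply measurableSet_ball]
      exact (hμ.1 _ (isOpen_ball.inter hΩ) ⟨x, mem_ball_self hs, hx⟩).ne'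
    · have hts : 0 < t - s := sub_pos.2 hst
      have h := ENNReal.toReal_mono (by
          have := hfin t
          finiteness) (rpow_measure_ball_le_of_embedding hμ.2 hp0 hps0 hemb x hst)
      rw [ENNReal.toReal_mul, ENNReal.toReal_mul, ← ENNReal.toReal_rpow, ← ENNReal.toReal_rpow,
        ENNReal.toReal_ofReal hCe.le, ENNReal.toReal_ofReal (by positivity)] at h
      have hm : 0 ≤ (μ.restrict Ω).real (ball x t) ^ (1 / p) := by positivity
      calc (t - s) * (μ.restrict Ω).real (ball x s) ^ (1 / pstar)
          ≤ (t - s) * (Ce * ((1 + (t - s)⁻¹) * (μ.restrict Ω).real (ball x t) ^ (1 / p))) :=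
            mul_le_mul_of_nonneg_left h hts.le
        _ = (t - s + 1) * (Ce * (μ.restrict Ω).real (ball x t) ^ (1 / p)) := by
            field_simp
        _ ≤ 2 * (Ce * (μ.restrict Ω).real (ball x t) ^ (1 / p)) :=
            mul_le_mul_of_nonneg_right (by linarith) (by positivity)
        _ = _ := by ring
  rw [← Measure.restrict_apply measurableSet_ball]
  refine ENNReal.ofReal_le_of_le_toReal ?_
  have h1 : D⁻¹ * R ≤ (μ.restrict Ω).real (ball x R) ^ (1 / Q) := by
    rw [← hQ, inv_mul_le_iff₀ hD0]
    exact hbound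
  calc D⁻¹ ^ Q * R ^ Q = (D⁻¹ * R) ^ Q := (Real.mul_rpow (by positivity) hR.le).symm
    _ ≤ ((μ.restrict Ω).real (ball x R) ^ (1 / Q)) ^ Q :=
        Real.rpow_le_rpow (by positivity) h1 hQ0.le
    _ = (μ.restrict Ω).real (ball x R) := by
        rw [← Real.rpow_mul measureReal_nonneg, one_div_mul_cancel hQ0.ne', Real.rpow_one]
end

section
/- Let (X,d,μ) be a connected Q-doubling metric measure space with Q > 1 and doubling constant C_d. Suppose there exist constants C₁, C₂ > 0 such that for every u ∈ M^{1,Q}(X) and every ball B ⊆ X one has the Trudinger-type estimate ⨍_B exp(C₁ |u − u_B| / ‖u‖_{M^{1,Q}(X)}) dμ ≤ C₂, where u_B denotes the average of u over B. Then there exists b = b(C₁, C₂, C_d) > 0 such that μ(B(x,r)) ≥ b r^Q for every x ∈ X and every 0 < r < min{1, diam(X)/2}. -/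
open MeasureTheory Metric Set ENNReal Filter

/-- The measure `μ` is doubling with constant `Cd`. -/
def IsDoublingWith {X : Type*} [MetricSpace X] [MeasurableSpace X]
    (μ : MeasureTheory.Measure X) (Cd : ℝ) : Prop :=
  1 ≤ Cd ∧ ∀ (x : X) (r : ℝ), 0 < r →
    μ (ball x (2 * r)) ≤ ENNReal.ofReal Cd * μ (ball x r)

/-- The space is `Q`-doubling: `μ` is doubling (with constant `Cd`) and there is `C ≥ 1`
with `(s/r)^Q ≤ C μ(B(x,s))/μ(B(a,r))` whenever `a ∈ X`, `x ∈ B(a,r)` and `0 < s ≤ r`. -/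
def IsQDoubling {X : Type*} [MetricSpace X] [MeasurableSpace X]
    (μ : MeasureTheory.Measure X) (Cd Q : ℝ) : Prop :=
  IsDoublingWith μ Cd ∧ ∃ C : ℝ, 1 ≤ C ∧ ∀ (a x : X) (r s : ℝ),
    x ∈ ball a r → 0 < s → s ≤ r →
      ENNReal.ofReal ((s / r) ^ Q) * μ (ball a r) ≤ ENNReal.ofReal C * μ (ball x s)

section LowerMassBound

variable {X : Type*} [MetricSpace X]

/-- The tent function of height one over the ball `ball x r`. -/
noncomputable def tent (x : X) (r : ℝ) (y : X) : ℝ := max 0 (1 - dist y x / r)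

lemma tent_nonneg (x : X) (r : ℝ) (y : X) : 0 ≤ tent x r y := le_max_left _ _

lemma continuous_tent (x : X) (r : ℝ) : Continuous (tent x r) := by
  unfold tent
  fun_prop

lemma tent_eq_zero {x y : X} {r : ℝ} (hr : 0 < r) (hy : y ∉ ball x r) : tent x r y = 0 := by
  rw [mem_ball, not_lt] at hy
  exact max_eq_left (sub_nonpos.2 ((one_le_div hr).2 hy))

lemma abs_tent_sub_le (x : X) {r : ℝ} (hr : 0 < r) (y z : X) :
    |tent x r y - tent x r z| ≤ dist y z / r := by
  refine (abs_max_sub_max_le_max _ _ _ _).trans (max_le (by simp; positivity) ?_)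
  rw [show 1 - dist y x / r - (1 - dist z x / r) = dist z x / r - dist y x / r by ring,
    ← sub_div, abs_div, abs_of_pos hr]
  gcongr
  rw [abs_sub_comm]
  exact abs_dist_sub_le y z x

lemma exists_dist_eq_of_lt_diam [ConnectedSpace X] {r t : ℝ} (ht : 0 ≤ t) (htr : t ≤ r)
    (hdiam : ENNReal.ofReal (2 * r) < Metric.ediam (univ : Set X)) (x : X) :
    ∃ y, dist y x = t := by
  obtain ⟨z, hz⟩ : ∃ z, r < dist z x := by
    by_contra! h
    refine hdiam.not_ge (Metric.ediam_le fun y _ z _ => ?_)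
    rw [edist_dist]
    refine ENNReal.ofReal_le_ofReal ?_
    linarith [dist_triangle_right y z x, h y, h z]
  have := intermediate_value_univ x z (f := fun y => dist y x) (by fun_prop)
  exact this ⟨by simpa using ht, htr.trans hz.le⟩

variable [MeasurableSpace X] {μ : MeasureTheory.Measure X}

lemma IsDoublingWith.measure_ball_pow_le {Cd D : ℝ} (h : IsDoublingWith μ Cd) (hD : Cd ≤ D)
    (x : X) {r : ℝ} (hr : 0 < r) (n : ℕ) :
    μ (ball x (2 ^ n * r)) ≤ ENNReal.ofReal D ^ n * μ (ball x r) := by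
  induction n with
  | zero => simp
  | succ n ih =>
    calc μ (ball x (2 ^ (n + 1) * r)) = μ (ball x (2 * (2 ^ n * r))) := by
          congr 2; ring
      _ ≤ ENNReal.ofReal Cd * μ (ball x (2 ^ n * r)) := h.2 x _ (by positivity)
      _ ≤ ENNReal.ofReal D * (ENNReal.ofReal D ^ n * μ (ball x r)) := by gcongr
      _ = ENNReal.ofReal D ^ (n + 1) * μ (ball x r) := by rw [pow_succ']; ring

lemma isHajlaszGradient_tent [OpensMeasurableSpace X] (x : X) {r : ℝ} (hr : 0 < r) :
    IsHajlaszGradient μ 1 univ (tent x r) ((ball x r).indicator fun _ => r⁻¹) := by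
  have hnn : ∀ y, 0 ≤ (ball x r).indicator (fun _ => r⁻¹) y :=
    fun y => indicator_nonneg (fun _ _ => by positivity) y
  refine ⟨measurable_const.indicator measurableSet_ball, hnn, ∅, empty_subset _, measure_empty,
    fun y _ z _ => ?_⟩
  rw [Real.rpow_one]
  by_cases h : y ∈ ball x r ∨ z ∈ ball x r
  · have hg : r⁻¹ ≤ (ball x r).indicator (fun _ => r⁻¹) y
        + (ball x r).indicator (fun _ => r⁻¹) z := by
      rcases h with h | h
      · have := hnn z
        rw [indicator_of_mem h]; linarith
      · have := hnn y
        rw [indicator_of_mem h]; linarith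
    calc _ ≤ dist y z / r := abs_tent_sub_le x hr y z
      _ = dist y z * r⁻¹ := div_eq_mul_inv _ _
      _ ≤ _ := by gcongr
  · push Not at h
    simp [tent_eq_zero hr h.1, tent_eq_zero hr h.2, h.1, h.2]

lemma MspNorm_tent_le [OpensMeasurableSpace X] {Q : ℝ} (hQ : 0 < Q) (x : X) {r : ℝ} (hr : 0 < r)
    (hr1 : r ≤ 1) :
    MspNorm μ 1 Q univ (tent x r) ≤ ENNReal.ofReal (2 / r) * μ (ball x r) ^ (1 / Q) := by
  have hQ0 : ENNReal.ofReal Q ≠ 0 := by simpa using hQ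
  have hg : eLpNorm ((ball x r).indicator fun _ => r⁻¹) (ENNReal.ofReal Q) (μ.restrict univ)
      = ENNReal.ofReal r⁻¹ * μ (ball x r) ^ (1 / Q) := by
    rw [Measure.restrict_univ,
      eLpNorm_indicator_const measurableSet_ball hQ0 ENNReal.ofReal_ne_top,
      ENNReal.toReal_ofReal hQ.le, Real.enorm_of_nonneg (by positivity)]
  have hu : eLpNorm (tent x r) (ENNReal.ofReal Q) (μ.restrict univ)
      ≤ eLpNorm ((ball x r).indicator fun _ => r⁻¹) (ENNReal.ofReal Q) (μ.restrict univ) := by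
    refine eLpNorm_mono_real fun y => ?_
    by_cases hy : y ∈ ball x r
    · rw [indicator_of_mem hy, Real.norm_of_nonneg (tent_nonneg x r y)]
      refine (max_le zero_le_one ?_).trans ((one_le_inv₀ hr).2 hr1)
      have : 0 ≤ dist y x / r := by positivity
      linarith
    · rw [indicator_of_notMem hy, tent_eq_zero hr hy, norm_zero]
  calc MspNorm μ 1 Q univ (tent x r)
      ≤ _ + _ := add_le_add hu (iInf₂_le _ (isHajlaszGradient_tent x hr))
    _ = ENNReal.ofReal (2 / r) * μ (ball x r) ^ (1 / Q) := by
        rw [hg, ← add_mul, ← ENNReal.ofReal_add (by positivity) (by positivity)]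
        congr 2
        ring

lemma MspNorm_tent_pos [OpensMeasurableSpace X] {Q : ℝ} (hQ : 0 < Q)
    (hμ : ∀ U : Set X, IsOpen U → U.Nonempty → 0 < μ U) (x : X) (r : ℝ) :
    0 < MspNorm μ 1 Q univ (tent x r) := by
  have : μ.IsOpenPosMeasure := ⟨fun U hU hne => (hμ U hU hne).ne'⟩
  refine lt_of_lt_of_le (pos_iff_ne_zero.2 fun h => ?_) le_self_add
  rw [Measure.restrict_univ, eLpNorm_eq_zero_iff (continuous_tent x r).aestronglyMeasurable
    (by simpa using hQ)] at h
  have h0 := congrFun (((continuous_tent x r).ae_eq_iff_eq μ continuous_zero).1 h) x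
  simp [tent] at h0

/-- Some set of comparable measure in the ball stays away from any prescribed value
of the tent function. -/
lemma exists_subset_ball_tent_sub_ge [ConnectedSpace X] {Cd D r : ℝ} (hd : IsDoublingWith μ Cd)
    (hD : Cd ≤ D) (hr : 0 < r)
    (hdiam : ENNReal.ofReal (2 * r) < Metric.ediam (univ : Set X)) (x : X) (c : ℝ) :
    ∃ A ⊆ ball x r, IsOpen A ∧ A.Nonempty ∧
      μ (ball x r) ≤ ENNReal.ofReal D ^ 4 * μ A ∧ ∀ y ∈ A, 1 / 4 ≤ |tent x r y - c| := by
  rcases le_total c (1 / 2) with hc | hc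
  · refine ⟨ball x (r / 4), ball_subset_ball (by linarith), isOpen_ball,
      nonempty_ball.2 (by positivity), (measure_mono (ball_subset_ball (by linarith))).trans
        (hd.measure_ball_pow_le hD x (by positivity) 4), fun y hy => ?_⟩
    have h1 : dist y x / r ≤ 1 / 4 := by
      rw [mem_ball] at hy
      rw [div_le_iff₀ hr]; linarith
    have h2 : 1 - dist y x / r ≤ tent x r y := le_max_right _ _
    exact le_trans (by linarith) (le_abs_self _)
  · obtain ⟨z, hz⟩ := exists_dist_eq_of_lt_diam (t := 7 / 8 * r) (by positivity) (by linarith)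
      hdiam x
    refine ⟨ball z (r / 8), ball_subset_ball' (by linarith), isOpen_ball,
      nonempty_ball.2 (by positivity), (measure_mono (ball_subset_ball' ?_)).trans
        (hd.measure_ball_pow_le hD z (by positivity) 4), fun y hy => ?_⟩
    · rw [dist_comm x z]; linarith
    · have h1 : 3 / 4 ≤ dist y x / r := by
        rw [mem_ball] at hy
        rw [le_div_iff₀ hr]
        linarith [dist_triangle_left z x y]
      have h2 : tent x r y ≤ 1 / 4 := max_le (by norm_num) (by linarith)
      exact le_trans (by linarith) (neg_le_abs _)

end LowerMassBound

/-- In a connected `Q`-doubling metric measure space (`Q > 1`, doubling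
constant `Cd`), a Trudinger-type exponential embedding for `M^{1,Q}(X)` (with constants
`C₁, C₂`) implies `μ(B(x,r)) ≥ b r^Q` for all `x` and `0 < r < min{1, diam X / 2}`,
with `b = b(C₁, C₂, Cd)`. -/
theorem trudinger_embedding_implies_lower_mass_bound
    (Q Cd C₁ C₂ : ℝ) (hQ : 1 < Q) (hC₁ : 0 < C₁) (hC₂ : 0 < C₂) :
    ∃ b : ℝ, 0 < b ∧
      ∀ (X : Type) [MetricSpace X] [MeasurableSpace X] [BorelSpace X]
        (μ : MeasureTheory.Measure X),
        IsMetricMeasureSpace μ → ConnectedSpace X → IsQDoubling μ Cd Q →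
        (∀ u : X → ℝ, MemMsp μ 1 Q Set.univ u →
          ∀ (z : X) (ρ : ℝ), 0 < ρ →
            ∫⁻ y in ball z ρ,
                ENNReal.ofReal (Real.exp (C₁ * |u y - ⨍ w in ball z ρ, u w ∂μ| /
                  (MspNorm μ 1 Q Set.univ u).toReal)) ∂μ
              ≤ ENNReal.ofReal C₂ * μ (ball z ρ)) →
        ∀ (x : X) (r : ℝ), 0 < r → r < 1 →
          ENNReal.ofReal (2 * r) < EMetric.diam (Set.univ : Set X) →
          ENNReal.ofReal (b * r ^ Q) ≤ μ (ball x r) := by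
  set D := max Cd 1
  have hD : 0 < D := lt_of_lt_of_le one_pos (le_max_right _ _)
  have hQ0 : 0 < Q := by linarith
  refine ⟨(C₁ / (8 * C₂ * D ^ 4)) ^ Q, by positivity, ?_⟩
  intro X _ _ _ μ ⟨hpos, hfin⟩ hconn ⟨hd, _⟩ H x r hr hr1 hdiam
  have hB : μ (ball x r) ≠ ⊤ := (hfin _ isBounded_ball).ne
  have hN := MspNorm_tent_le (μ := μ) hQ0 x hr hr1.le
  have htop : ENNReal.ofReal (2 / r) * μ (ball x r) ^ (1 / Q) ≠ ⊤ :=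
    ENNReal.mul_ne_top ENNReal.ofReal_ne_top
      (ENNReal.rpow_ne_top_of_nonneg (by positivity) hB)
  have hNtop := ne_top_of_le_ne_top htop hN
  have hNpos : 0 < (MspNorm μ 1 Q univ (tent x r)).toReal :=
    ENNReal.toReal_pos (MspNorm_tent_pos hQ0 hpos x r).ne' hNtop
  have hNle : (MspNorm μ 1 Q univ (tent x r)).toReal
      ≤ 2 / r * (μ (ball x r)).toReal ^ (1 / Q) := by
    have := ENNReal.toReal_mono htop hN
    rwa [ENNReal.toReal_mul, ENNReal.toReal_ofReal (by positivity),
      ← ENNReal.toReal_rpow] at this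
  have hT := H (tent x r)
    ⟨(continuous_tent x r).aestronglyMeasurable, hNtop.lt_top⟩ x r hr
  set N := (MspNorm μ 1 Q univ (tent x r)).toReal
  set c := ⨍ w in ball x r, tent x r w ∂μ
  obtain ⟨A, hAB, hAo, hAne, hA, hAc⟩ :=
    exists_subset_ball_tent_sub_ge hd (le_max_left Cd 1) hr hdiam x c
  have hAtop : μ A ≠ ⊤ := ne_top_of_le_ne_top hB (measure_mono hAB)
  have hmul : ENNReal.ofReal (C₁ * (1 / 4) / N) * μ A
      ≤ ENNReal.ofReal (C₂ * D ^ 4) * μ A := by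
    calc ENNReal.ofReal (C₁ * (1 / 4) / N) * μ A
        = ∫⁻ _ in A, ENNReal.ofReal (C₁ * (1 / 4) / N) ∂μ := (setLIntegral_const _ _).symm
      _ ≤ ∫⁻ y in A, ENNReal.ofReal (Real.exp (C₁ * |tent x r y - c| / N)) ∂μ := by
          refine setLIntegral_mono' hAo.measurableSet fun y hy => ENNReal.ofReal_le_ofReal ?_
          have h1 : C₁ * (1 / 4) / N ≤ C₁ * |tent x r y - c| / N := by
            gcongr
            exact hAc y hy
          linarith [Real.add_one_le_exp (C₁ * |tent x r y - c| / N)]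
      _ ≤ ∫⁻ y in ball x r, ENNReal.ofReal (Real.exp (C₁ * |tent x r y - c| / N)) ∂μ :=
          lintegral_mono_set hAB
      _ ≤ ENNReal.ofReal C₂ * μ (ball x r) := hT
      _ ≤ ENNReal.ofReal C₂ * (ENNReal.ofReal D ^ 4 * μ A) := by gcongr
      _ = ENNReal.ofReal (C₂ * D ^ 4) * μ A := by
          rw [ENNReal.ofReal_mul hC₂.le, ENNReal.ofReal_pow hD.le, mul_assoc]
  have hle : C₁ * (1 / 4) / N ≤ C₂ * D ^ 4 :=
    (ENNReal.ofReal_le_ofReal_iff (by positivity)).1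
      ((ENNReal.mul_le_mul_iff_left (hpos A hAo hAne).ne' hAtop).1 hmul)
  have hroot : C₁ / (8 * C₂ * D ^ 4) * r ≤ (μ (ball x r)).toReal ^ (1 / Q) := by
    rw [div_le_iff₀ hNpos] at hle
    have h2 := hle.trans (mul_le_mul_of_nonneg_left hNle (by positivity))
    rw [div_mul_eq_mul_div, div_le_iff₀ (by positivity)]
    have h3 := mul_le_mul_of_nonneg_right h2 hr.le
    field_simp at h3
    linarith
  rw [← Real.mul_rpow (by positivity) hr.le]
  refine ENNReal.ofReal_le_of_le_toReal ?_
  calc _ ≤ ((μ (ball x r)).toReal ^ (1 / Q)) ^ Q := by gcongr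
    _ = (μ (ball x r)).toReal := by
      rw [← Real.rpow_mul ENNReal.toReal_nonneg, one_div_mul_cancel hQ0.ne', Real.rpow_one]
end

section
/- Let (X,d,μ) be a metric measure space, 0 < s < 1, F ⊆ X measurable, and let u be a bounded L-Lipschitz function supported in F. Let k_L ∈ ℤ satisfy 2^{k_L − 1} < L ≤ 2^{k_L}, and define the sequence (g_k)_{k∈ℤ} by g_k = 2^{k(s−1)} L χ_{supp u} if k ≥ k_L and g_k = 2^{sk+2} ‖u‖_∞ χ_{supp u} if k < k_L. Then (g_k)_{k∈ℤ} is a fractional s-gradient of u; that is, for all k ∈ ℤ and all x, y ∈ X with 2^{−k−1} ≤ d(x,y) < 2^{−k}, one has |u(x) − u(y)| ≤ d(x,y)^s (g_k(x) + g_k(y)). -/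
open MeasureTheory Metric Set ENNReal Filter

/-- The sequence `(g_k)_{k ∈ ℤ}` of Lemma 3.1: `g_k = 2^{k(s-1)} L χ_{supp u}` for
`k ≥ k_L` and `g_k = 2^{sk+2} ‖u‖_∞ χ_{supp u}` for `k < k_L`, where
`‖u‖_∞ = ⨆ z, |u z|`. -/
noncomputable def lipGradSeq {X : Type*} [MetricSpace X] (s L : ℝ) (kL : ℤ)
    (u : X → ℝ) : ℤ → X → ℝ := fun k x =>
  if kL ≤ k then
    (2 : ℝ) ^ ((k : ℝ) * (s - 1)) * L * (Function.support u).indicator (fun _ => (1 : ℝ)) x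
  else
    (2 : ℝ) ^ (s * (k : ℝ) + 2) * (⨆ z, |u z|) *
      (Function.support u).indicator (fun _ => (1 : ℝ)) x

/-- Two nonnegative multiples of the indicator of the support of `u` control `|u x - u y|`
as soon as the multiplier does: if neither point is in the support, then `u x = u y`. -/
lemma abs_sub_le_mul_indicator_support {X : Type*} (u : X → ℝ) (x y : X) {a c : ℝ}
    (ha : 0 ≤ a) (hc : 0 ≤ c) (h : |u x - u y| ≤ a * c) :
    |u x - u y| ≤ a * (c * (Function.support u).indicator (fun _ => (1 : ℝ)) x +
      c * (Function.support u).indicator (fun _ => (1 : ℝ)) y) := by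
  have hac : 0 ≤ a * c := mul_nonneg ha hc
  by_cases hx : u x = 0 <;> by_cases hy : u y = 0 <;>
    simp only [Set.indicator, Function.mem_support, hx, hy, ne_eq, not_true_eq_false,
      not_false_eq_true, if_true, if_false, mul_one, mul_zero, add_zero, zero_add,
      sub_zero, zero_sub, abs_zero, le_refl] at h ⊢ <;> linarith

/-- If `u` is a bounded `L`-Lipschitz function supported in a measurable
set `F` and `2^{k_L-1} < L ≤ 2^{k_L}`, then the sequence `(g_k)` defined above is a
fractional `s`-gradient of `u`: for all `k ∈ ℤ` and all `x, y` with
`2^{-k-1} ≤ d(x,y) < 2^{-k}` one has `|u(x)-u(y)| ≤ d(x,y)^s (g_k(x)+g_k(y))`. -/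
theorem lipGradSeq_is_fractional_gradient
    {X : Type*} [MetricSpace X] [MeasurableSpace X] [BorelSpace X]
    (μ : MeasureTheory.Measure X) (hX : IsMetricMeasureSpace μ)
    (s : ℝ) (hs : 0 < s) (hs1 : s < 1)
    (F : Set X) (hF : MeasurableSet F)
    (u : X → ℝ) (L : ℝ) (kL : ℤ)
    (hsupp : Function.support u ⊆ F)
    (hbdd : BddAbove (Set.range fun x => |u x|))
    (hLip : ∀ x y : X, |u x - u y| ≤ L * dist x y)
    (hkL₁ : (2 : ℝ) ^ ((kL : ℝ) - 1) < L) (hkL₂ : L ≤ (2 : ℝ) ^ (kL : ℝ)) :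
    ∀ (k : ℤ) (x y : X),
      (2 : ℝ) ^ (-(k : ℝ) - 1) ≤ dist x y → dist x y < (2 : ℝ) ^ (-(k : ℝ)) →
      |u x - u y| ≤ dist x y ^ s * (lipGradSeq s L kL u k x + lipGradSeq s L kL u k y) := by
  intro k x y hd₁ hd₂
  have hd : 0 < dist x y := lt_of_lt_of_le (by positivity) hd₁
  have hL : 0 < L := lt_trans (by positivity) hkL₁
  have hds : 0 ≤ dist x y ^ s := by positivity
  unfold lipGradSeq
  split_ifs with hk
  · refine abs_sub_le_mul_indicator_support u x y hds (by positivity) ?_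
    have hpow : dist x y ^ (1 - s) ≤ (2 : ℝ) ^ ((k : ℝ) * (s - 1)) := by
      calc dist x y ^ (1 - s) ≤ ((2 : ℝ) ^ (-(k : ℝ))) ^ (1 - s) :=
            Real.rpow_le_rpow hd.le hd₂.le (by linarith)
        _ = (2 : ℝ) ^ ((k : ℝ) * (s - 1)) := by
            rw [← Real.rpow_mul (by norm_num)]
            congr 1
            ring
    have hsplit : dist x y = dist x y ^ s * dist x y ^ (1 - s) := by
      rw [← Real.rpow_add hd, add_sub_cancel, Real.rpow_one]
    calc |u x - u y| ≤ L * dist x y := hLip x y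
      _ = dist x y ^ s * (dist x y ^ (1 - s) * L) := by
          conv_lhs => rw [hsplit]
          ring
      _ ≤ dist x y ^ s * ((2 : ℝ) ^ ((k : ℝ) * (s - 1)) * L) := by gcongr
  · have hM : 0 ≤ ⨆ z, |u z| := Real.iSup_nonneg fun z => abs_nonneg (u z)
    refine abs_sub_le_mul_indicator_support u x y hds (by positivity) ?_
    have hpow : 2 ≤ dist x y ^ s * (2 : ℝ) ^ (s * (k : ℝ) + 2) := by
      calc (2 : ℝ) = (2 : ℝ) ^ (1 : ℝ) := (Real.rpow_one 2).symm
        _ ≤ (2 : ℝ) ^ ((-(k : ℝ) - 1) * s + (s * (k : ℝ) + 2)) :=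
            Real.rpow_le_rpow_of_exponent_le (by norm_num) (by linarith)
        _ = ((2 : ℝ) ^ (-(k : ℝ) - 1)) ^ s * (2 : ℝ) ^ (s * (k : ℝ) + 2) := by
            rw [Real.rpow_add (by norm_num), Real.rpow_mul (by norm_num)]
        _ ≤ dist x y ^ s * (2 : ℝ) ^ (s * (k : ℝ) + 2) := by gcongr
    calc |u x - u y| ≤ |u x| + |u y| := abs_sub _ _
      _ ≤ 2 * ⨆ z, |u z| := by
          linarith [le_ciSup hbdd x, le_ciSup hbdd y]
      _ ≤ dist x y ^ s * (2 : ℝ) ^ (s * (k : ℝ) + 2) * ⨆ z, |u z| := by gcongr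
      _ = dist x y ^ s * ((2 : ℝ) ^ (s * (k : ℝ) + 2) * ⨆ z, |u z|) := by ring
end

section
/- Let 0 < s < 1, 0 < p < ∞, 0 < q ≤ ∞, and let (X,d,μ) be a metric measure space with doubling measure μ. Let p* > p and define Q by 1/p − 1/p* = s/Q. Suppose the embedding M^s_{p,q}(X) ↪ L^{p*}(X) holds with constant C_e, i.e., ‖u‖_{L^{p*}(X)} ≤ C_e ‖u‖_{M^s_{p,q}(X)} for all u ∈ M^s_{p,q}(X). Then there exists a constant C = C(s,p,q,p*,C_e) > 0, independent of the doubling constant, such that μ(B(x,r)) ≥ C r^Q for every x ∈ X and every r ∈ (0,1]. -/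
open MeasureTheory Metric Set ENNReal Filter

/-- `(g_k)_{k ∈ ℤ}` is a fractional `s`-gradient of `u` on `X`: the `g_k` are nonnegative
measurable, and off a null set `E`, `|u(x)-u(y)| ≤ d(x,y)^s (g_k(x)+g_k(y))` whenever
`2^{-k-1} ≤ d(x,y) < 2^{-k}`. -/
def IsFractionalSGradient {X : Type*} [MetricSpace X] [MeasurableSpace X]
    (μ : MeasureTheory.Measure X) (s : ℝ) (u : X → ℝ) (g : ℤ → X → ℝ) : Prop :=
  (∀ k, Measurable (g k)) ∧ (∀ k x, 0 ≤ g k x) ∧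
  ∃ E : Set X, μ E = 0 ∧ ∀ (k : ℤ), ∀ x ∉ E, ∀ y ∉ E,
    (2 : ℝ) ^ (-(k : ℝ) - 1) ≤ dist x y → dist x y < (2 : ℝ) ^ (-(k : ℝ)) →
      |u x - u y| ≤ dist x y ^ s * (g k x + g k y)

/-- The `l^q` "norm" of a sequence indexed by `ℤ`, with values in `ℝ≥0∞`:
`(Σ_k a_k^q)^{1/q}` for `q < ∞` and `sup_k a_k` for `q = ∞`. -/
noncomputable def lqNormSeq (q : ℝ≥0∞) (a : ℤ → ℝ≥0∞) : ℝ≥0∞ :=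
  if q = ∞ then ⨆ k, a k else (∑' k, a k ^ q.toReal) ^ (1 / q.toReal)

/-- The mixed norm `‖(g_k)‖_{L^p(X, l^q)} = ‖ ‖(g_k(·))‖_{l^q} ‖_{L^p(X)}`. -/
noncomputable def LplqNorm {X : Type*} [MeasurableSpace X]
    (μ : MeasureTheory.Measure X) (p : ℝ) (q : ℝ≥0∞) (g : ℤ → X → ℝ) : ℝ≥0∞ :=
  (∫⁻ x, lqNormSeq q (fun k => ENNReal.ofReal (g k x)) ^ p ∂μ) ^ (1 / p)

/-- The mixed norm `‖(g_k)‖_{l^q(L^p(X))} = ‖ (‖g_k‖_{L^p(X)})_k ‖_{l^q}`. -/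
noncomputable def lqLpNorm {X : Type*} [MeasurableSpace X]
    (μ : MeasureTheory.Measure X) (p : ℝ) (q : ℝ≥0∞) (g : ℤ → X → ℝ) : ℝ≥0∞ :=
  lqNormSeq q (fun k => (∫⁻ x, ENNReal.ofReal (g k x) ^ p ∂μ) ^ (1 / p))

/-- The Hajłasz–Triebel–Lizorkin `M^s_{p,q}(X)` norm. -/
noncomputable def MTLNorm {X : Type*} [MetricSpace X] [MeasurableSpace X]
    (μ : MeasureTheory.Measure X) (s p : ℝ) (q : ℝ≥0∞) (u : X → ℝ) : ℝ≥0∞ :=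
  eLpNorm u (ENNReal.ofReal p) μ +
    ⨅ (g : ℤ → X → ℝ) (_ : IsFractionalSGradient μ s u g), LplqNorm μ p q g

/-- Membership in the Hajłasz–Triebel–Lizorkin space `M^s_{p,q}(X)`. -/
def MemMTL {X : Type*} [MetricSpace X] [MeasurableSpace X]
    (μ : MeasureTheory.Measure X) (s p : ℝ) (q : ℝ≥0∞) (u : X → ℝ) : Prop :=
  AEStronglyMeasurable u μ ∧ MTLNorm μ s p q u < ⊤

/-- The Hajłasz–Besov `N^s_{p,q}(X)` norm. -/
noncomputable def NBesovNorm {X : Type*} [MetricSpace X] [MeasurableSpace X]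
    (μ : MeasureTheory.Measure X) (s p : ℝ) (q : ℝ≥0∞) (u : X → ℝ) : ℝ≥0∞ :=
  eLpNorm u (ENNReal.ofReal p) μ +
    ⨅ (g : ℤ → X → ℝ) (_ : IsFractionalSGradient μ s u g), lqLpNorm μ p q g

/-- Membership in the Hajłasz–Besov space `N^s_{p,q}(X)`. -/
def MemNBesov {X : Type*} [MetricSpace X] [MeasurableSpace X]
    (μ : MeasureTheory.Measure X) (s p : ℝ) (q : ℝ≥0∞) (u : X → ℝ) : Prop :=
  AEStronglyMeasurable u μ ∧ NBesovNorm μ s p q u < ⊤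

theorem lqNormSeq_comp_equiv (q : ℝ≥0∞) (a : ℤ → ℝ≥0∞) (e : ℤ ≃ ℤ) :
    lqNormSeq q (fun k => a (e k)) = lqNormSeq q a := by
  unfold lqNormSeq
  split_ifs
  · exact e.iSup_comp (g := a)
  · rw [e.tsum_eq (fun k => a k ^ q.toReal)]

theorem lqNormSeq_const_mul {q : ℝ≥0∞} (hq : 0 < q) (c : ℝ≥0∞) (a : ℤ → ℝ≥0∞) :
    lqNormSeq q (fun k => c * a k) = c * lqNormSeq q a := by
  unfold lqNormSeq
  split_ifs with h
  · rw [ENNReal.mul_iSup]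
  · have hq' : 0 < q.toReal := ENNReal.toReal_pos hq.ne' h
    simp_rw [ENNReal.mul_rpow_of_nonneg _ _ hq'.le]
    rw [ENNReal.tsum_mul_left, ENNReal.mul_rpow_of_nonneg _ _ (by positivity),
      ← ENNReal.rpow_mul, mul_one_div_cancel hq'.ne', ENNReal.rpow_one]

theorem lqNormSeq_zero {q : ℝ≥0∞} (hq : 0 < q) : lqNormSeq q (fun _ => 0) = 0 := by
  simpa using lqNormSeq_const_mul hq 0 (fun _ => 0)

/-- The two-sided exponentially decaying weight `2 · 2^{-σ|j|}`. -/
noncomputable def expWeight (σ : ℝ) (j : ℤ) : ℝ := 2 * 2 ^ (-(σ * |(j : ℝ)|))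

theorem expWeight_pos (σ : ℝ) (j : ℤ) : 0 < expWeight σ j := by
  unfold expWeight; positivity

theorem lqNormSeq_expWeight_lt_top {σ : ℝ} (hσ : 0 < σ) {q : ℝ≥0∞} (hq : 0 < q) :
    lqNormSeq q (fun j => ENNReal.ofReal (expWeight σ j)) < ⊤ := by
  unfold lqNormSeq
  split_ifs with h
  · refine lt_of_le_of_lt (iSup_le fun j => ENNReal.ofReal_le_ofReal (?_ : _ ≤ (2 : ℝ)))
      ENNReal.ofReal_lt_top
    have : (2 : ℝ) ^ (-(σ * |(j : ℝ)|)) ≤ 1 :=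
      Real.rpow_le_one_of_one_le_of_nonpos one_le_two (by
        have := mul_nonneg hσ.le (abs_nonneg (j : ℝ)); linarith)
    unfold expWeight; linarith
  · have hq' : 0 < q.toReal := ENNReal.toReal_pos hq.ne' h
    refine ENNReal.rpow_lt_top_of_nonneg (by positivity) ?_
    have hterm : ∀ j : ℤ, ENNReal.ofReal (expWeight σ j) ^ q.toReal
        = ENNReal.ofReal (expWeight σ j ^ q.toReal) := fun j =>
      ENNReal.ofReal_rpow_of_nonneg (expWeight_pos σ j).le hq'.le
    simp_rw [hterm]
    have hgeom : Summable fun n : ℕ => (2 : ℝ) ^ q.toReal * ((2 : ℝ) ^ (-(σ * q.toReal))) ^ n := by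
      refine (summable_geometric_of_lt_one (by positivity) ?_).mul_left _
      exact Real.rpow_lt_one_of_one_lt_of_neg one_lt_two (by
        have := mul_pos hσ hq'; linarith)
    have hval : ∀ (j : ℤ) (n : ℕ), |(j : ℝ)| = n → expWeight σ j ^ q.toReal
        = (2 : ℝ) ^ q.toReal * ((2 : ℝ) ^ (-(σ * q.toReal))) ^ n := by
      intro j n hj
      unfold expWeight
      rw [hj, Real.mul_rpow (by positivity) (by positivity), ← Real.rpow_natCast,
        ← Real.rpow_mul (by positivity), ← Real.rpow_mul (by positivity)]
      ring_nf
    have hsum : Summable fun j : ℤ => expWeight σ j ^ q.toReal := by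
      refine Summable.of_nat_of_neg ?_ ?_
      · exact hgeom.congr fun n => (hval _ n (by simp)).symm
      · exact hgeom.congr fun n => (hval _ n (by simp)).symm
    exact hsum.tsum_ofReal_ne_top

theorem min_one_two_mul_le_rpow_mul_expWeight {s : ℝ} (hs : 0 < s) (hs1 : s < 1) {t : ℝ} {n : ℤ}
    (h1 : (2 : ℝ) ^ ((n : ℝ) - 1) ≤ t) (h2 : t < (2 : ℝ) ^ (n : ℝ)) :
    min 1 (2 * t) ≤ t ^ s * expWeight (min s (1 - s)) n := by
  have ht : 0 < t := lt_of_lt_of_le (by positivity) h1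
  unfold expWeight
  rcases le_or_gt n 0 with hn | hn
  · have hn' : (n : ℝ) ≤ 0 := by exact_mod_cast hn
    refine (min_le_right _ _).trans ?_
    have e1 : t = t ^ s * t ^ (1 - s) := by
      rw [← Real.rpow_add ht]; simp
    have e2 : t ^ (1 - s) ≤ 2 ^ (-(min s (1 - s) * |(n : ℝ)|)) := by
      calc t ^ (1 - s) ≤ ((2 : ℝ) ^ (n : ℝ)) ^ (1 - s) :=
            Real.rpow_le_rpow ht.le h2.le (by linarith)
        _ = 2 ^ ((n : ℝ) * (1 - s)) := by rw [← Real.rpow_mul (by positivity)]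
        _ ≤ _ := by
            refine Real.rpow_le_rpow_of_exponent_le one_le_two ?_
            rw [abs_of_nonpos hn']
            nlinarith [min_le_right s (1 - s)]
    calc 2 * t = t ^ s * (2 * t ^ (1 - s)) := by rw [mul_left_comm, ← e1]
      _ ≤ _ := by gcongr
  · have hn' : (0 : ℝ) < n := by exact_mod_cast hn
    refine (min_le_left _ _).trans ?_
    have e1 : (2 : ℝ) ^ (((n : ℝ) - 1) * s) ≤ t ^ s := by
      rw [Real.rpow_mul (by positivity)]
      exact Real.rpow_le_rpow (by positivity) h1 hs.le
    calc (1 : ℝ) = 2 ^ (0 : ℝ) := by simp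
      _ ≤ 2 ^ (((n : ℝ) - 1) * s + (1 + -(min s (1 - s) * |(n : ℝ)|))) := by
          refine Real.rpow_le_rpow_of_exponent_le one_le_two ?_
          rw [abs_of_pos hn']
          nlinarith [min_le_left s (1 - s)]
      _ = 2 ^ (((n : ℝ) - 1) * s) * (2 * 2 ^ (-(min s (1 - s) * |(n : ℝ)|))) := by
          rw [Real.rpow_add two_pos, Real.rpow_add two_pos, Real.rpow_one]
      _ ≤ _ := by gcongr

/-- The Lipschitz bump equal to `1` on the ball of radius `R / 2` and vanishing off the ball of
radius `R`. -/
noncomputable def ballBump {X : Type*} [MetricSpace X] (x : X) (R : ℝ) (y : X) : ℝ :=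
  max 0 (min 1 (2 - 2 * dist y x / R))

section ballBump

variable {X : Type*} [MetricSpace X] {x : X} {R : ℝ}

theorem ballBump_nonneg (x : X) (R : ℝ) (y : X) : 0 ≤ ballBump x R y := le_max_left _ _

theorem ballBump_le_one (x : X) (R : ℝ) (y : X) : ballBump x R y ≤ 1 :=
  max_le zero_le_one (min_le_left _ _)

theorem continuous_ballBump (x : X) (R : ℝ) : Continuous (ballBump x R) := by
  unfold ballBump; fun_prop

theorem ballBump_eq_zero (hR : 0 < R) {y : X} (hy : y ∉ ball x R) : ballBump x R y = 0 := by
  rw [mem_ball, not_lt] at hy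
  have : 2 ≤ 2 * dist y x / R := by rw [le_div_iff₀ hR]; linarith
  exact max_eq_left ((min_le_right _ _).trans (by linarith))

theorem ballBump_eq_one (hR : 0 < R) {y : X} (hy : y ∈ ball x (R / 2)) : ballBump x R y = 1 := by
  rw [mem_ball] at hy
  have : 2 * dist y x / R ≤ 1 := by rw [div_le_iff₀ hR]; linarith
  unfold ballBump
  rw [min_eq_left (by linarith), max_eq_right zero_le_one]

theorem abs_ballBump_sub_le (hR : 0 < R) (y z : X) :
    |ballBump x R y - ballBump x R z| ≤ min 1 (2 * (dist y z / R)) := by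
  refine le_min ?_ ?_
  · have := ballBump_nonneg x R y
    have := ballBump_nonneg x R z
    have := ballBump_le_one x R y
    have := ballBump_le_one x R z
    rw [abs_le]; constructor <;> linarith
  · unfold ballBump
    refine (abs_max_sub_max_le_max _ _ _ _).trans ?_
    rw [sub_self, abs_zero, max_eq_right (abs_nonneg _)]
    refine (abs_min_sub_min_le_max _ _ _ _).trans ?_
    rw [sub_self, abs_zero, max_eq_right (abs_nonneg _)]
    have e : 2 - 2 * dist y x / R - (2 - 2 * dist z x / R) = 2 * ((dist z x - dist y x) / R) := by
      ring
    rw [e, abs_mul, abs_div, abs_of_pos hR, abs_two]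
    gcongr
    rw [dist_comm y z]
    exact abs_dist_sub_le z y x

variable [MeasurableSpace X] [BorelSpace X]

theorem isFractionalSGradient_ballBump (μ : Measure X) {s : ℝ} (hs : 0 < s) (hs1 : s < 1)
    (x : X) (n : ℤ) :
    IsFractionalSGradient μ s (ballBump x ((2 : ℝ) ^ (-(n : ℝ)))) fun k =>
      (ball x ((2 : ℝ) ^ (-(n : ℝ)))).indicator fun _ =>
        (2 : ℝ) ^ (n * s) * expWeight (min s (1 - s)) (n - k) := by
  set R : ℝ := (2 : ℝ) ^ (-(n : ℝ)) with hRdef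
  have hR : 0 < R := by positivity
  have hc : ∀ k : ℤ, 0 ≤ (2 : ℝ) ^ (n * s) * expWeight (min s (1 - s)) (n - k) := fun k =>
    mul_nonneg (by positivity) (expWeight_pos _ _).le
  refine ⟨fun k => measurable_const.indicator measurableSet_ball,
    fun k y => indicator_nonneg (fun _ _ => hc k) y, ∅, measure_empty, ?_⟩
  intro k y _ z _ h1 h2
  beta_reduce
  by_cases hyz : y ∈ ball x R ∨ z ∈ ball x R
  · have hscale : dist y z / R = 2 ^ (n : ℝ) * dist y z := by
      rw [hRdef, Real.rpow_neg two_pos.le]; field_simp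
    have ht1 : (2 : ℝ) ^ (((n - k : ℤ) : ℝ) - 1) ≤ dist y z / R := by
      have : (((n - k : ℤ) : ℝ) - 1) = (n : ℝ) + (-(k : ℝ) - 1) := by push_cast; ring
      rw [hscale, this, Real.rpow_add two_pos]
      gcongr
    have ht2 : dist y z / R < (2 : ℝ) ^ ((n - k : ℤ) : ℝ) := by
      have : ((n - k : ℤ) : ℝ) = (n : ℝ) + (-(k : ℝ)) := by push_cast; ring
      rw [hscale, this, Real.rpow_add two_pos]
      gcongr
    have key := (abs_ballBump_sub_le (x := x) hR y z).trans
      (min_one_two_mul_le_rpow_mul_expWeight hs hs1 ht1 ht2)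
    rw [hscale, Real.mul_rpow (by positivity) dist_nonneg, ← Real.rpow_mul two_pos.le] at key
    refine key.trans ?_
    rw [mul_comm ((2 : ℝ) ^ _) (dist y z ^ s), mul_assoc]
    refine mul_le_mul_of_nonneg_left ?_ (by positivity)
    rcases hyz with h | h
    · rw [indicator_of_mem h]
      exact le_add_of_nonneg_right (indicator_nonneg (fun _ _ => hc k) z)
    · rw [indicator_of_mem h]
      exact le_add_of_nonneg_left (indicator_nonneg (fun _ _ => hc k) y)
  · rw [not_or] at hyz
    rw [ballBump_eq_zero hR hyz.1, ballBump_eq_zero hR hyz.2, indicator_of_notMem hyz.1,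
      indicator_of_notMem hyz.2]
    simp

end ballBump

theorem LplqNorm_indicator {X : Type*} [MeasurableSpace X] (μ : Measure X) {p : ℝ} (hp : 0 < p)
    {q : ℝ≥0∞} (hq : 0 < q) {B : Set X} (hB : MeasurableSet B) (c : ℤ → ℝ) :
    LplqNorm μ p q (fun k => B.indicator fun _ => c k)
      = lqNormSeq q (fun k => ENNReal.ofReal (c k)) * μ B ^ (1 / p) := by
  unfold LplqNorm
  have h : (fun x => lqNormSeq q (fun k => ENNReal.ofReal (B.indicator (fun _ => c k) x)) ^ p)
      = B.indicator fun _ => lqNormSeq q (fun k => ENNReal.ofReal (c k)) ^ p := by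
    funext x
    by_cases hx : x ∈ B
    · simp only [indicator_of_mem hx]
    · simp only [indicator_of_notMem hx, ENNReal.ofReal_zero, lqNormSeq_zero hq,
        ENNReal.zero_rpow_of_pos hp]
  rw [h, lintegral_indicator_const hB, ENNReal.mul_rpow_of_nonneg _ _ (by positivity),
    ← ENNReal.rpow_mul, mul_one_div_cancel hp.ne', ENNReal.rpow_one]

theorem MTLNorm_ballBump_le {X : Type*} [MetricSpace X] [MeasurableSpace X] [BorelSpace X]
    (μ : Measure X) {s p : ℝ} (hs : 0 < s) (hs1 : s < 1) (hp : 0 < p) {q : ℝ≥0∞} (hq : 0 < q)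
    (x : X) (n : ℕ) :
    MTLNorm μ s p q (ballBump x ((2 : ℝ) ^ (-(n : ℝ)))) ≤
      (1 + lqNormSeq q (fun j => ENNReal.ofReal (expWeight (min s (1 - s)) j))) *
        ENNReal.ofReal (2 ^ (n * s)) * μ (ball x ((2 : ℝ) ^ (-(n : ℝ)))) ^ (1 / p) := by
  set R : ℝ := (2 : ℝ) ^ (-(n : ℝ)) with hRdef
  have hR : 0 < R := by positivity
  set A := lqNormSeq q (fun j => ENNReal.ofReal (expWeight (min s (1 - s)) j)) with hA
  have hp' : ENNReal.ofReal p ≠ 0 := by simpa using hp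
  have hone : (1 : ℝ≥0∞) ≤ ENNReal.ofReal (2 ^ (n * s)) := by
    rw [← ENNReal.ofReal_one]
    exact ENNReal.ofReal_le_ofReal (Real.one_le_rpow one_le_two (by positivity))
  have hLp : eLpNorm (ballBump x R) (ENNReal.ofReal p) μ ≤ μ (ball x R) ^ (1 / p) := by
    have hmono : eLpNorm (ballBump x R) (ENNReal.ofReal p) μ ≤
        eLpNorm ((ball x R).indicator fun _ => (1 : ℝ)) (ENNReal.ofReal p) μ := by
      refine eLpNorm_mono fun y => ?_
      by_cases hy : y ∈ ball x R
      · rw [indicator_of_mem hy, Real.norm_of_nonneg (ballBump_nonneg x R y), norm_one]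
        exact ballBump_le_one x R y
      · rw [indicator_of_notMem hy, ballBump_eq_zero hR hy]
    refine hmono.trans_eq ?_
    rw [eLpNorm_indicator_const measurableSet_ball hp' ENNReal.ofReal_ne_top,
      ENNReal.toReal_ofReal hp.le]
    simp
  have hgrad := isFractionalSGradient_ballBump μ hs hs1 x (n : ℤ)
  simp only [Int.cast_natCast, ← hRdef] at hgrad
  have hseq : lqNormSeq q (fun k => ENNReal.ofReal
      ((2 : ℝ) ^ (n * s) * expWeight (min s (1 - s)) (n - k)))
      = ENNReal.ofReal (2 ^ (n * s)) * A := by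
    simp_rw [ENNReal.ofReal_mul (by positivity : (0 : ℝ) ≤ 2 ^ (n * s))]
    rw [lqNormSeq_const_mul hq, hA]
    congr 1
    exact lqNormSeq_comp_equiv q (fun j => ENNReal.ofReal (expWeight (min s (1 - s)) j))
      (Equiv.subLeft (n : ℤ))
  have hinf : (⨅ (g : ℤ → X → ℝ) (_ : IsFractionalSGradient μ s (ballBump x R) g),
      LplqNorm μ p q g) ≤ ENNReal.ofReal (2 ^ (n * s)) * A * μ (ball x R) ^ (1 / p) := by
    refine (iInf₂_le _ hgrad).trans_eq ?_
    rw [LplqNorm_indicator μ hp hq measurableSet_ball, hseq]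
  calc MTLNorm μ s p q (ballBump x R)
      ≤ 1 * μ (ball x R) ^ (1 / p)
        + ENNReal.ofReal (2 ^ (n * s)) * A * μ (ball x R) ^ (1 / p) := by
        rw [one_mul]; exact add_le_add hLp hinf
    _ ≤ ENNReal.ofReal (2 ^ (n * s)) * μ (ball x R) ^ (1 / p)
        + ENNReal.ofReal (2 ^ (n * s)) * A * μ (ball x R) ^ (1 / p) := by gcongr
    _ = _ := by ring

theorem measure_ball_half_rpow_le_eLpNorm_ballBump {X : Type*} [MetricSpace X] [MeasurableSpace X]
    [BorelSpace X] (μ : Measure X) {p R : ℝ} (hp : 0 < p) (hR : 0 < R) (x : X) :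
    μ (ball x (R / 2)) ^ (1 / p) ≤ eLpNorm (ballBump x R) (ENNReal.ofReal p) μ := by
  have hp' : ENNReal.ofReal p ≠ 0 := by simpa using hp
  have h : eLpNorm ((ball x (R / 2)).indicator fun _ => (1 : ℝ)) (ENNReal.ofReal p) μ
      = μ (ball x (R / 2)) ^ (1 / p) := by
    rw [eLpNorm_indicator_const measurableSet_ball hp' ENNReal.ofReal_ne_top,
      ENNReal.toReal_ofReal hp.le]
    simp
  rw [← h]
  refine eLpNorm_mono fun y => ?_
  by_cases hy : y ∈ ball x (R / 2)
  · rw [indicator_of_mem hy, ballBump_eq_one hR hy]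
  · rw [indicator_of_notMem hy, norm_zero]
    exact norm_nonneg _

/-- A sequence with `a x_{n+1} ≤ x_n` for some `0 < a < 1` that decreases at most linearly is
nonnegative. -/
theorem nonneg_of_mul_succ_le_of_linear_lower_bound {a D : ℝ} (ha : 0 < a) (ha1 : a < 1)
    {x : ℕ → ℝ} (h1 : ∀ n, a * x (n + 1) ≤ x n) (h2 : ∀ n, x n - D ≤ x (n + 1)) (n : ℕ) :
    0 ≤ x n := by
  have h3 : ∀ j : ℕ, a ^ j * x (n + j) ≤ x n := by
    intro j
    induction j with
    | zero => simp
    | succ j ih =>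
      refine le_trans ?_ ih
      rw [pow_succ, mul_assoc]
      exact mul_le_mul_of_nonneg_left (h1 (n + j)) (by positivity)
  have h4 : ∀ j : ℕ, x n - j * D ≤ x (n + j) := by
    intro j
    induction j with
    | zero => simp
    | succ j ih =>
      have := h2 (n + j)
      rw [← add_assoc]; push_cast; linarith
  have h5 : ∀ j : ℕ, a ^ j * x n - (j * a ^ j) * D ≤ x n := by
    intro j
    have := mul_le_mul_of_nonneg_left (h4 j) (pow_nonneg ha.le j)
    linarith [h3 j]
  have hlim : Tendsto (fun j : ℕ => a ^ j * x n - (j * a ^ j) * D) atTop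
      (nhds (0 * x n - 0 * D)) :=
    ((tendsto_pow_atTop_nhds_zero_of_lt_one ha.le ha1).mul_const _).sub
      ((tendsto_self_mul_const_pow_of_lt_one ha.le ha1).mul_const _)
  have := le_of_tendsto' hlim h5
  simpa using this

theorem measure_ball_succ_rpow_le_of_embedding {X : Type*} [MetricSpace X] [MeasurableSpace X]
    [BorelSpace X] {μ : Measure X} {s p pstar Ce : ℝ} {q : ℝ≥0∞} (hs : 0 < s) (hs1 : s < 1)
    (hp : 0 < p) (hq : 0 < q) (hpstar : 0 < pstar)
    (hμ : ∀ t : Set X, Bornology.IsBounded t → μ t < ⊤)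
    (hemb : ∀ u : X → ℝ, MemMTL μ s p q u →
      eLpNorm u (ENNReal.ofReal pstar) μ ≤ ENNReal.ofReal Ce * MTLNorm μ s p q u)
    (x : X) (n : ℕ) :
    μ (ball x ((2 : ℝ) ^ (-((n + 1 : ℕ) : ℝ)))) ^ (1 / pstar) ≤
      ENNReal.ofReal Ce *
        ((1 + lqNormSeq q (fun j => ENNReal.ofReal (expWeight (min s (1 - s)) j))) *
          ENNReal.ofReal (2 ^ (n * s)) * μ (ball x ((2 : ℝ) ^ (-(n : ℝ)))) ^ (1 / p)) := by
  have hle := MTLNorm_ballBump_le μ hs hs1 hp hq x n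
  have hA := lqNormSeq_expWeight_lt_top (lt_min hs (sub_pos.2 hs1)) hq
  have hfin : MTLNorm μ s p q (ballBump x ((2 : ℝ) ^ (-(n : ℝ)))) < ⊤ := by
    refine lt_of_le_of_lt hle (ENNReal.mul_lt_top (ENNReal.mul_lt_top ?_ ENNReal.ofReal_lt_top) ?_)
    · exact ENNReal.add_lt_top.2 ⟨ENNReal.one_lt_top, hA⟩
    · exact ENNReal.rpow_lt_top_of_nonneg (by positivity) (hμ _ isBounded_ball).ne
  have hhalf : (2 : ℝ) ^ (-((n + 1 : ℕ) : ℝ)) = (2 : ℝ) ^ (-(n : ℝ)) / 2 := by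
    have : (-((n + 1 : ℕ) : ℝ)) = -(n : ℝ) - 1 := by push_cast; ring
    rw [this, Real.rpow_sub two_pos, Real.rpow_one]
  rw [hhalf]
  refine (measure_ball_half_rpow_le_eLpNorm_ballBump μ hpstar (by positivity) x).trans ?_
  refine (hemb _ ⟨(continuous_ballBump x _).measurable.aestronglyMeasurable, hfin⟩).trans ?_
  gcongr

/-- For `0 < s < 1`, `0 < p < ∞`, `0 < q ≤ ∞`, `p* > p` with
`1/p - 1/p* = s/Q`: if the embedding `M^s_{p,q}(X) ↪ L^{p*}(X)` holds with constant `C_e`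
on a metric measure space with doubling measure, then `μ(B(x,r)) ≥ C r^Q` for all `x` and
`r ∈ (0,1]`, where `C = C(s,p,q,p*,C_e)` is independent of the doubling constant. -/
theorem triebelLizorkin_embedding_implies_lower_mass_bound
    (s p pstar Q Ce : ℝ) (q : ℝ≥0∞)
    (hs : 0 < s) (hs1 : s < 1) (hp : 0 < p) (hq : 0 < q)
    (hppstar : p < pstar) (hQ : 1 / p - 1 / pstar = s / Q) (hCe : 0 < Ce) :
    ∃ C : ℝ, 0 < C ∧
      ∀ (X : Type) [MetricSpace X] [MeasurableSpace X] [BorelSpace X]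
        (μ : MeasureTheory.Measure X),
        IsMetricMeasureSpace μ → (∃ Cd : ℝ, IsDoublingWith μ Cd) →
        (∀ u : X → ℝ, MemMTL μ s p q u →
          eLpNorm u (ENNReal.ofReal pstar) μ ≤ ENNReal.ofReal Ce * MTLNorm μ s p q u) →
        ∀ (x : X) (r : ℝ), 0 < r → r ≤ 1 →
          ENNReal.ofReal (C * r ^ Q) ≤ μ (ball x r) := by
  have hpstar : 0 < pstar := hp.trans hppstar
  have hQpos : 0 < Q := by
    have h : 0 < s / Q := by
      rw [← hQ, sub_pos]; exact one_div_lt_one_div_of_lt hp hppstar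
    exact (div_pos_iff_of_pos_left hs).1 h
  set A := lqNormSeq q (fun j => ENNReal.ofReal (expWeight (min s (1 - s)) j)) with hA
  have hAtop : 1 + A ≠ ⊤ := (ENNReal.add_lt_top.2
    ⟨ENNReal.one_lt_top, lqNormSeq_expWeight_lt_top (lt_min hs (sub_pos.2 hs1)) hq⟩).ne
  have hApos : 0 < (1 + A).toReal :=
    ENNReal.toReal_pos (ne_of_gt (lt_of_lt_of_le one_pos le_self_add)) hAtop
  set K := Real.log Ce + Real.log (1 + A).toReal with hK
  set a := p / pstar with ha
  have ha0 : 0 < a := div_pos hp hpstar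
  have ha1 : a < 1 := (div_lt_one hpstar).2 hppstar
  have hQa : Q * (1 - a) = s * p := by
    rw [ha]
    field_simp at hQ ⊢
    linarith
  set κ := (p * K + a * (Q * Real.log 2)) / (1 - a) with hκ
  have hκa : κ * (1 - a) = p * K + a * (Q * Real.log 2) :=
    div_mul_cancel₀ _ (sub_pos.2 ha1).ne'
  refine ⟨Real.exp (-κ) * 2 ^ (-Q), by positivity, ?_⟩
  intro X _ _ _ μ ⟨hμpos, hμfin⟩ ⟨Cd, hCd1, hCd⟩ hemb x r hr hr1
  set m : ℕ → ℝ := fun n => (μ (ball x ((2 : ℝ) ^ (-(n : ℝ))))).toReal with hm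
  have hfin : ∀ R : ℝ, μ (ball x R) ≠ ⊤ := fun R => (hμfin _ isBounded_ball).ne
  have hmpos : ∀ n, 0 < m n := fun n =>
    ENNReal.toReal_pos (hμpos _ isOpen_ball ⟨x, mem_ball_self (by positivity)⟩).ne' (hfin _)
  have hstep : ∀ n : ℕ, Real.log (m (n + 1)) / pstar ≤
      K + n * s * Real.log 2 + Real.log (m n) / p := by
    intro n
    have h := measure_ball_succ_rpow_le_of_embedding hs hs1 hp hq hpstar hμfin hemb x n
    have h' := ENNReal.toReal_mono (by
      refine ENNReal.mul_ne_top ENNReal.ofReal_ne_top (ENNReal.mul_ne_top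
        (ENNReal.mul_ne_top hAtop ENNReal.ofReal_ne_top) ?_)
      exact ENNReal.rpow_ne_top_of_nonneg (by positivity) (hfin _)) h
    rw [ENNReal.toReal_mul, ENNReal.toReal_mul, ENNReal.toReal_mul, ← ENNReal.toReal_rpow,
      ← ENNReal.toReal_rpow, ENNReal.toReal_ofReal hCe.le,
      ENNReal.toReal_ofReal (by positivity)] at h'
    change m (n + 1) ^ (1 / pstar) ≤
      Ce * ((1 + A).toReal * 2 ^ (n * s) * m n ^ (1 / p)) at h'
    have hm0 := hmpos n
    have hm1 := hmpos (n + 1)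
    have h'' := Real.log_le_log (by positivity) h'
    rw [Real.log_mul (by positivity) (by positivity), Real.log_mul (by positivity) (by positivity),
      Real.log_mul (by positivity) (by positivity), Real.log_rpow hm1, Real.log_rpow hm0,
      Real.log_rpow two_pos] at h''
    rw [div_eq_inv_mul, div_eq_inv_mul, ← one_div, ← one_div, hK]
    linarith
  have hdoub : ∀ n : ℕ, Real.log (m n) ≤ Real.log Cd + Real.log (m (n + 1)) := by
    intro n
    have h := hCd x ((2 : ℝ) ^ (-((n + 1 : ℕ) : ℝ))) (by positivity)
    have hdbl : 2 * (2 : ℝ) ^ (-((n + 1 : ℕ) : ℝ)) = (2 : ℝ) ^ (-(n : ℝ)) := by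
      have : (-((n + 1 : ℕ) : ℝ)) = -(n : ℝ) - 1 := by push_cast; ring
      rw [this, Real.rpow_sub two_pos, Real.rpow_one]; ring
    rw [hdbl] at h
    have h' := ENNReal.toReal_mono (ENNReal.mul_ne_top ENNReal.ofReal_ne_top (hfin _)) h
    rw [ENNReal.toReal_mul, ENNReal.toReal_ofReal (by linarith)] at h'
    rw [← Real.log_mul (by linarith) (hmpos (n + 1)).ne']
    exact Real.log_le_log (hmpos n) h'
  have hnonneg := nonneg_of_mul_succ_le_of_linear_lower_bound (D := Real.log Cd) ha0 ha1
    (x := fun n => Real.log (m n) + n * (Q * Real.log 2) + κ)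
    (fun n => by
      have h := mul_le_mul_of_nonneg_left (hstep n) hp.le
      have e1 : p * (Real.log (m (n + 1)) / pstar) = a * Real.log (m (n + 1)) := by
        rw [ha]; ring
      have e2 : p * (K + n * s * Real.log 2 + Real.log (m n) / p)
          = p * K + n * (s * p) * Real.log 2 + Real.log (m n) := by
        field_simp
      rw [e1, e2, ← hQa] at h
      push_cast
      linarith)
    (fun n => by
      have := hdoub n
      have : 0 ≤ Q * Real.log 2 := mul_nonneg hQpos.le (Real.log_nonneg one_le_two)
      push_cast
      linarith)
  obtain ⟨n, hn1, hn2⟩ := exists_nat_pow_near_of_lt_one hr hr1 (by norm_num : (0 : ℝ) < 1 / 2)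
    (by norm_num)
  have hpow : ∀ k : ℕ, (1 / 2 : ℝ) ^ k = (2 : ℝ) ^ (-(k : ℝ)) := fun k => by
    rw [Real.rpow_neg two_pos.le, Real.rpow_natCast, one_div, inv_pow]
  rw [hpow] at hn1 hn2
  have hsub : μ (ball x ((2 : ℝ) ^ (-((n + 1 : ℕ) : ℝ)))) ≤ μ (ball x r) :=
    measure_mono (ball_subset_ball hn1.le)
  refine le_trans ?_ hsub
  rw [← ENNReal.ofReal_toReal (hfin ((2 : ℝ) ^ (-((n + 1 : ℕ) : ℝ))))]
  refine ENNReal.ofReal_le_ofReal ?_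
  change _ ≤ m (n + 1)
  calc Real.exp (-κ) * 2 ^ (-Q) * r ^ Q
      ≤ Real.exp (-κ) * 2 ^ (-Q) * ((2 : ℝ) ^ (-(n : ℝ))) ^ Q := by gcongr
    _ = Real.exp (-κ - ((n + 1 : ℕ) : ℝ) * (Q * Real.log 2)) := by
        rw [← Real.rpow_mul two_pos.le, Real.rpow_def_of_pos two_pos, Real.rpow_def_of_pos two_pos,
          ← Real.exp_add, ← Real.exp_add]
        congr 1
        push_cast
        ring
    _ ≤ Real.exp (Real.log (m (n + 1))) := by
        refine Real.exp_le_exp.2 ?_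
        have := hnonneg (n + 1)
        linarith
    _ = m (n + 1) := Real.exp_log (hmpos _)
end

section
/- Let 0 < s < 1, 0 < p < ∞, 0 < q ≤ ∞, and let (X,d,μ) be a metric measure space with doubling measure μ. Let p* > p and define Q by 1/p − 1/p* = s/Q. Suppose the embedding N^s_{p,q}(X) ↪ L^{p*}(X) holds with constant C_e, i.e., ‖u‖_{L^{p*}(X)} ≤ C_e ‖u‖_{N^s_{p,q}(X)} for all u ∈ N^s_{p,q}(X). Then there exists a constant C = C(s,p,q,p*,C_e) > 0, independent of the doubling constant, such that μ(B(x,r)) ≥ C r^Q for every x ∈ X and every r ∈ (0,1]. -/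
open MeasureTheory Metric Set ENNReal Filter

theorem lqNormSeq_sub_right (q : ℝ≥0∞) (a : ℤ → ℝ≥0∞) (n : ℤ) :
    lqNormSeq q (fun k => a (k - n)) = lqNormSeq q a := by
  unfold lqNormSeq
  split_ifs
  · exact (Equiv.subRight n).iSup_comp (g := a)
  · rw [← (Equiv.subRight n).tsum_eq (fun k => a k ^ q.toReal)]
    rfl

theorem lqNormSeq_geometric_lt_top {q : ℝ≥0∞} (hq : 0 < q) {t : ℝ} (ht : 0 < t)
    (ht1 : t < 1) : lqNormSeq q (fun k => ENNReal.ofReal (t ^ k.natAbs)) < ⊤ := by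
  unfold lqNormSeq
  split_ifs with h
  · refine lt_of_le_of_lt (iSup_le fun k => ?_) ENNReal.one_lt_top
    exact ENNReal.ofReal_le_one.2 (pow_le_one₀ ht.le ht1.le)
  · have hq' : 0 < q.toReal := ENNReal.toReal_pos hq.ne' h
    refine ENNReal.rpow_lt_top_of_nonneg (by positivity) (ne_of_lt ?_)
    have hpow : ∀ k : ℤ, ENNReal.ofReal (t ^ k.natAbs) ^ q.toReal =
        ENNReal.ofReal ((t ^ q.toReal) ^ k.natAbs) := fun k => by
      rw [ENNReal.ofReal_rpow_of_pos (by positivity), ← Real.rpow_natCast, ← Real.rpow_natCast,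
        ← Real.rpow_mul ht.le, ← Real.rpow_mul ht.le, mul_comm]
    simp_rw [hpow]
    have hgeom : Summable fun n : ℕ => (t ^ q.toReal) ^ n :=
      summable_geometric_of_lt_one (by positivity) (Real.rpow_lt_one ht.le ht1 hq')
    have hsum : Summable fun k : ℤ => (t ^ q.toReal) ^ k.natAbs :=
      Summable.of_nat_of_neg (by simpa using hgeom) (by simpa using hgeom)
    exact hsum.tsum_ofReal_lt_top

/-- The decay rate, away from scale `2^{-N}`, of the gradient of a `2^N`-Lipschitz function. -/
noncomputable def decayRate (s : ℝ) : ℝ := (2 : ℝ) ^ (-min s (1 - s))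

theorem decayRate_pos (s : ℝ) : 0 < decayRate s := Real.rpow_pos_of_pos two_pos _

theorem decayRate_lt_one {s : ℝ} (hs : 0 < s) (hs1 : s < 1) : decayRate s < 1 :=
  Real.rpow_lt_one_of_one_lt_of_neg one_lt_two
    (neg_lt_zero.2 (lt_min hs (sub_pos.2 hs1)))

/-- If `d < 2^{-k}` and `2^{-k-1} ≤ d`, then `min 1 (2^N d)` is at most `d^s` times a multiple
of `2^{Ns}` which decays geometrically in `|k - N|`. -/
theorem le_rpow_mul_decayRate_pow {s d v : ℝ} (hs : 0 < s) (hs1 : s < 1) (N : ℕ) (k : ℤ)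
    (hd : (2 : ℝ) ^ (-(k : ℝ) - 1) ≤ d) (hd' : d < (2 : ℝ) ^ (-(k : ℝ)))
    (hv : v ≤ 1) (hvd : v ≤ 2 ^ N * d) :
    v ≤ d ^ s * (2 * (2 ^ N) ^ s * decayRate s ^ (k - N).natAbs) := by
  have hd0 : 0 < d := lt_of_lt_of_le (by positivity) hd
  have hcoef : 2 * ((2 : ℝ) ^ N) ^ s * decayRate s ^ (k - N).natAbs =
      2 ^ (1 + N * s - min s (1 - s) * |(k : ℝ) - N|) := by
    rw [decayRate, ← Real.rpow_natCast, ← Real.rpow_natCast, ← Real.rpow_mul two_pos.le,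
      ← Real.rpow_mul two_pos.le, Nat.cast_natAbs, sub_eq_add_neg (1 + (N : ℝ) * s),
      Real.rpow_add two_pos, Real.rpow_add two_pos, Real.rpow_one, neg_mul]
    push_cast
    rfl
  rw [hcoef]
  rcases le_total (k : ℝ) N with hk | hk
  · calc v ≤ 1 := hv
      _ = ((2 : ℝ) ^ (-(k : ℝ) - 1)) ^ s * 2 ^ (((k : ℝ) + 1) * s) := by
        rw [← Real.rpow_mul two_pos.le, ← Real.rpow_add two_pos]
        ring_nf
        exact (Real.rpow_zero 2).symm
      _ ≤ _ := by
        gcongr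
        · exact one_le_two
        · rw [abs_of_nonpos (by linarith)]
          nlinarith [min_le_left s (1 - s)]
  · calc v ≤ 2 ^ N * d := hvd
      _ = d ^ s * (2 ^ (N : ℝ) * d ^ (1 - s)) := by
        rw [Real.rpow_natCast, mul_left_comm, ← Real.rpow_add hd0, add_sub_cancel, Real.rpow_one]
      _ ≤ d ^ s * (2 ^ (N : ℝ) * ((2 : ℝ) ^ (-(k : ℝ))) ^ (1 - s)) := by
        gcongr
      _ ≤ _ := by
        rw [← Real.rpow_mul two_pos.le, ← Real.rpow_add two_pos]
        gcongr
        · exact one_le_two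
        · rw [abs_of_nonneg (by linarith)]
          nlinarith [min_le_right s (1 - s)]

section Bump

variable {X : Type*} [MetricSpace X]

/-- The cutoff function of slope `2^N` supported in `ball x R`. -/
noncomputable def bump (x : X) (R : ℝ) (N : ℕ) (y : X) : ℝ :=
  max 0 (min 1 (2 ^ N * (R - dist y x)))

theorem bump_nonneg (x : X) (R : ℝ) (N : ℕ) (y : X) : 0 ≤ bump x R N y := le_max_left _ _

theorem bump_le_one (x : X) (R : ℝ) (N : ℕ) (y : X) : bump x R N y ≤ 1 :=
  max_le zero_le_one (min_le_left _ _)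

theorem continuous_bump (x : X) (R : ℝ) (N : ℕ) : Continuous (bump x R N) := by
  unfold bump
  fun_prop

theorem bump_eq_zero {x : X} {R : ℝ} {N : ℕ} {y : X} (hy : y ∉ ball x R) :
    bump x R N y = 0 := by
  have hy : R ≤ dist y x := not_lt.1 hy
  exact max_eq_left ((min_le_right _ _).trans
    (mul_nonpos_of_nonneg_of_nonpos (by positivity) (by linarith)))

theorem bump_eq_one {x : X} {R ρ : ℝ} {N : ℕ} (hN : 1 ≤ 2 ^ N * (R - ρ)) {y : X}
    (hy : y ∈ ball x ρ) : bump x R N y = 1 := by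
  have hy : dist y x < ρ := hy
  have h : 1 ≤ 2 ^ N * (R - dist y x) := hN.trans (by gcongr)
  rw [bump, min_eq_left h, max_eq_right zero_le_one]

theorem abs_bump_sub_le_one (x : X) (R : ℝ) (N : ℕ) (y z : X) :
    |bump x R N y - bump x R N z| ≤ 1 := by
  rw [abs_le]
  constructor <;>
    linarith [bump_nonneg x R N y, bump_nonneg x R N z, bump_le_one x R N y, bump_le_one x R N z]

theorem abs_bump_sub_le_dist (x : X) (R : ℝ) (N : ℕ) (y z : X) :
    |bump x R N y - bump x R N z| ≤ 2 ^ N * dist y z := by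
  calc |bump x R N y - bump x R N z|
      ≤ |min 1 (2 ^ N * (R - dist y x)) - min 1 (2 ^ N * (R - dist z x))| := by
        simpa [bump] using abs_max_sub_max_le_max 0 (min 1 (2 ^ N * (R - dist y x))) 0
          (min 1 (2 ^ N * (R - dist z x)))
    _ ≤ |2 ^ N * (R - dist y x) - 2 ^ N * (R - dist z x)| := by
        simpa using abs_min_sub_min_le_max 1 (2 ^ N * (R - dist y x)) 1
          (2 ^ N * (R - dist z x))
    _ = 2 ^ N * |dist z x - dist y x| := by
        rw [← mul_sub, abs_mul, abs_of_nonneg (by positivity : (0 : ℝ) ≤ 2 ^ N)]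
        ring_nf
    _ ≤ 2 ^ N * dist y z := by
        rw [dist_comm y z]
        gcongr
        exact abs_dist_sub_le z y x

variable [MeasurableSpace X] [BorelSpace X]

theorem isFractionalSGradient_bump (μ : Measure X) {s : ℝ} (hs : 0 < s) (hs1 : s < 1)
    (x : X) (R : ℝ) (N : ℕ) :
    IsFractionalSGradient μ s (bump x R N) (fun k => (ball x R).indicator
      fun _ => 2 * (2 ^ N) ^ s * decayRate s ^ (k - N).natAbs) := by
  have hτ := decayRate_pos s
  have hnonneg : ∀ (k : ℤ) (y : X), 0 ≤ (ball x R).indicator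
      (fun _ => 2 * (2 ^ N) ^ s * decayRate s ^ (k - N).natAbs) y := fun k y =>
    indicator_nonneg (fun _ _ => by positivity) y
  refine ⟨fun k => measurable_const.indicator measurableSet_ball, hnonneg, ∅, measure_empty, ?_⟩
  intro k y _ z _ hd hd'
  have key := le_rpow_mul_decayRate_pow hs hs1 N k hd hd' (abs_bump_sub_le_one x R N y z)
    (abs_bump_sub_le_dist x R N y z)
  by_cases hy : y ∈ ball x R
  · refine key.trans ?_
    gcongr
    beta_reduce
    rw [indicator_of_mem hy]
    exact le_add_of_nonneg_right (hnonneg k z)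
  by_cases hz : z ∈ ball x R
  · refine key.trans ?_
    gcongr
    beta_reduce
    rw [indicator_of_mem hz]
    exact le_add_of_nonneg_left (hnonneg k y)
  rw [bump_eq_zero hy, bump_eq_zero hz, sub_zero, abs_zero]
  exact mul_nonneg (by positivity) (add_nonneg (hnonneg k y) (hnonneg k z))

theorem lqLpNorm_indicator_ball (μ : Measure X) {p : ℝ} {q : ℝ≥0∞} (hp : 0 < p) (hq : 0 < q)
    {c t : ℝ} (hc : 0 ≤ c) (n : ℤ) (x : X) (R : ℝ) :
    lqLpNorm μ p q (fun k => (ball x R).indicator fun _ => c * t ^ (k - n).natAbs) =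
      ENNReal.ofReal c * μ (ball x R) ^ (1 / p) *
        lqNormSeq q (fun k => ENNReal.ofReal (t ^ k.natAbs)) := by
  have hterm : ∀ a : ℝ, (∫⁻ y, ENNReal.ofReal ((ball x R).indicator (fun _ => a) y) ^ p ∂μ) ^
      (1 / p) = ENNReal.ofReal a * μ (ball x R) ^ (1 / p) := fun a => by
    have hind : (fun y => ENNReal.ofReal ((ball x R).indicator (fun _ => a) y) ^ p) =
        (ball x R).indicator fun _ => ENNReal.ofReal a ^ p := by
      ext y
      by_cases hy : y ∈ ball x R <;> simp [hy, hp]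
    rw [hind, lintegral_indicator_const measurableSet_ball,
      ENNReal.mul_rpow_of_nonneg _ _ (by positivity), ← ENNReal.rpow_mul,
      mul_one_div_cancel hp.ne', ENNReal.rpow_one]
  unfold lqLpNorm
  simp_rw [hterm, ENNReal.ofReal_mul hc, mul_right_comm (ENNReal.ofReal c) (ENNReal.ofReal _)]
  rw [lqNormSeq_const_mul hq,
    lqNormSeq_sub_right q (fun k => ENNReal.ofReal (t ^ k.natAbs)) n]

theorem NBesovNorm_bump_le (μ : Measure X) {s p : ℝ} {q : ℝ≥0∞} (hs : 0 < s) (hs1 : s < 1)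
    (hp : 0 < p) (hq : 0 < q) (x : X) (R : ℝ) (N : ℕ) :
    NBesovNorm μ s p q (bump x R N) ≤
      (1 + ENNReal.ofReal (2 * (2 ^ N) ^ s) *
        lqNormSeq q (fun k => ENNReal.ofReal (decayRate s ^ k.natAbs))) *
          μ (ball x R) ^ (1 / p) := by
  rw [add_mul, one_mul, mul_right_comm]
  refine add_le_add ?_ ((iInf₂_le _ (isFractionalSGradient_bump μ hs hs1 x R N)).trans_eq
    (lqLpNorm_indicator_ball μ hp hq (by positivity) N x R))
  calc eLpNorm (bump x R N) (ENNReal.ofReal p) μ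
      ≤ eLpNorm ((ball x R).indicator fun _ => (1 : ℝ)) (ENNReal.ofReal p) μ := by
        refine eLpNorm_mono fun y => ?_
        by_cases hy : y ∈ ball x R
        · simpa [hy, abs_of_nonneg (bump_nonneg x R N y)] using bump_le_one x R N y
        · simp [hy, bump_eq_zero hy]
    _ = μ (ball x R) ^ (1 / p) := by
        rw [eLpNorm_indicator_const measurableSet_ball (by simpa using hp) ENNReal.ofReal_ne_top,
          ENNReal.toReal_ofReal hp.le]
        simp

/-- Testing the embedding on a bump function compares the measures of concentric balls. -/
theorem measure_ball_rpow_le_of_embedding (μ : Measure X) {s p pstar Ce K : ℝ} {q : ℝ≥0∞}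
    (hs : 0 < s) (hs1 : s < 1) (hp : 0 < p) (hq : 0 < q) (hpstar : 0 < pstar)
    (hK : lqNormSeq q (fun k => ENNReal.ofReal (decayRate s ^ k.natAbs)) ≤ ENNReal.ofReal K)
    (hfin : ∀ (x : X) (r : ℝ), μ (ball x r) < ⊤) (hCe : 0 < Ce) (hK0 : 0 ≤ K)
    (hemb : ∀ u : X → ℝ, MemNBesov μ s p q u →
      eLpNorm u (ENNReal.ofReal pstar) μ ≤ ENNReal.ofReal Ce * NBesovNorm μ s p q u)
    (x : X) {R ρ : ℝ} {N : ℕ} (hN : 1 ≤ 2 ^ N * (R - ρ)) :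
    μ.real (ball x ρ) ^ (1 / pstar) ≤
      Ce * (1 + 2 * K) * (2 ^ N) ^ s * μ.real (ball x R) ^ (1 / p) := by
  have hone : (1 : ℝ) ≤ (2 ^ N) ^ s :=
    Real.one_le_rpow (one_le_pow₀ one_le_two) hs.le
  have hnorm : NBesovNorm μ s p q (bump x R N) ≤
      ENNReal.ofReal ((1 + 2 * K) * (2 ^ N) ^ s * μ.real (ball x R) ^ (1 / p)) := by
    refine (NBesovNorm_bump_le μ hs hs1 hp hq x R N).trans ?_
    rw [ENNReal.ofReal_mul (p := (1 + 2 * K) * (2 ^ N) ^ s) (by positivity),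
      ← ENNReal.ofReal_rpow_of_nonneg measureReal_nonneg (by positivity),
      ofReal_measureReal (hfin x R).ne]
    gcongr
    calc 1 + ENNReal.ofReal (2 * (2 ^ N) ^ s) *
          lqNormSeq q (fun k => ENNReal.ofReal (decayRate s ^ k.natAbs))
        ≤ ENNReal.ofReal 1 + ENNReal.ofReal (2 * (2 ^ N) ^ s) * ENNReal.ofReal K := by
          rw [ENNReal.ofReal_one]
          gcongr
      _ = ENNReal.ofReal (1 + 2 * (2 ^ N) ^ s * K) := by
          rw [← ENNReal.ofReal_mul (by positivity),
            ENNReal.ofReal_add zero_le_one (by positivity)]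
      _ ≤ _ := ENNReal.ofReal_le_ofReal (by linarith)
  have hmem : MemNBesov μ s p q (bump x R N) :=
    ⟨(continuous_bump x R N).measurable.aestronglyMeasurable,
      hnorm.trans_lt ENNReal.ofReal_lt_top⟩
  have hlow : μ (ball x ρ) ^ (1 / pstar) ≤ eLpNorm (bump x R N) (ENNReal.ofReal pstar) μ := by
    calc μ (ball x ρ) ^ (1 / pstar)
        = eLpNorm ((ball x ρ).indicator fun _ => (1 : ℝ)) (ENNReal.ofReal pstar) μ := by
          rw [eLpNorm_indicator_const measurableSet_ball (by simpa using hpstar)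
            ENNReal.ofReal_ne_top, ENNReal.toReal_ofReal hpstar.le]
          simp
      _ ≤ _ := by
          refine eLpNorm_mono fun y => ?_
          by_cases hy : y ∈ ball x ρ
          · simp [hy, bump_eq_one hN hy]
          · simp [hy]
  have h := hlow.trans ((hemb _ hmem).trans (mul_le_mul_right hnorm _))
  rw [← ENNReal.ofReal_mul hCe.le, ← ofReal_measureReal (hfin x ρ).ne,
    ENNReal.ofReal_rpow_of_nonneg measureReal_nonneg (by positivity),
    ENNReal.ofReal_le_ofReal_iff (by positivity)] at h
  linarith

end Bump

/-- A sequence bounded below with `b_j ≥ α - β j + θ b_{j+1}` and `θ < 1` satisfies the lower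
bound on `b_0` that iterating the recursion infinitely often gives. -/
theorem le_of_recursive_lower_bound {b : ℕ → ℝ} {α β θ m : ℝ} (hβ : 0 ≤ β) (hθ : 0 ≤ θ)
    (hθ1 : θ < 1) (hm : ∀ j, m ≤ b j) (hb : ∀ j, α - β * j + θ * b (j + 1) ≤ b j) :
    (α - θ * (β / (1 - θ))) / (1 - θ) ≤ b 0 := by
  have h1θ : 0 < 1 - θ := sub_pos.2 hθ1
  set γ := β / (1 - θ)
  set δ := (α - θ * γ) / (1 - θ)
  have hγeq : γ * (1 - θ) = β := div_mul_cancel₀ _ h1θ.ne'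
  have hδeq : δ * (1 - θ) = α - θ * γ := div_mul_cancel₀ _ h1θ.ne'
  have hγ0 : 0 ≤ γ := by positivity
  have hstep : ∀ j : ℕ, θ * (b (j + 1) - δ + γ * (j + 1 : ℕ)) ≤ b j - δ + γ * j := fun j => by
    have := hb j
    push_cast
    linear_combination this + hδeq - (j : ℝ) * hγeq
  have hiter : ∀ n : ℕ, θ ^ n * (b n - δ + γ * n) ≤ b 0 - δ := fun n => by
    induction n with
    | zero => simp
    | succ n ih =>
      refine le_trans ?_ ih
      rw [pow_succ, mul_assoc]
      exact mul_le_mul_of_nonneg_left (hstep n) (by positivity)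
  have hbound : ∀ n : ℕ, θ ^ n * (m - δ) ≤ b 0 - δ := fun n => by
    refine le_trans ?_ (hiter n)
    have : 0 ≤ γ * n := by positivity
    gcongr
    linarith [hm n]
  have hlim : Tendsto (fun n : ℕ => θ ^ n * (m - δ)) atTop (nhds (0 * (m - δ))) :=
    (tendsto_pow_atTop_nhds_zero_of_lt_one hθ hθ1).mul_const _
  have := le_of_tendsto' hlim hbound
  linarith

/-- For `0 < s < 1`, `0 < p < ∞`, `0 < q ≤ ∞`, `p* > p` with
`1/p - 1/p* = s/Q`: if the embedding `N^s_{p,q}(X) ↪ L^{p*}(X)` holds with constant `C_e`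
on a metric measure space with doubling measure, then `μ(B(x,r)) ≥ C r^Q` for all `x` and
`r ∈ (0,1]`, where `C = C(s,p,q,p*,C_e)` is independent of the doubling constant. -/
theorem besov_embedding_implies_lower_mass_bound
    (s p pstar Q Ce : ℝ) (q : ℝ≥0∞)
    (hs : 0 < s) (hs1 : s < 1) (hp : 0 < p) (hq : 0 < q)
    (hppstar : p < pstar) (hQ : 1 / p - 1 / pstar = s / Q) (hCe : 0 < Ce) :
    ∃ C : ℝ, 0 < C ∧
      ∀ (X : Type) [MetricSpace X] [MeasurableSpace X] [BorelSpace X]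
        (μ : MeasureTheory.Measure X),
        IsMetricMeasureSpace μ → (∃ Cd : ℝ, IsDoublingWith μ Cd) →
        (∀ u : X → ℝ, MemNBesov μ s p q u →
          eLpNorm u (ENNReal.ofReal pstar) μ ≤ ENNReal.ofReal Ce * NBesovNorm μ s p q u) →
        ∀ (x : X) (r : ℝ), 0 < r → r ≤ 1 →
          ENNReal.ofReal (C * r ^ Q) ≤ μ (ball x r) := by
  have hpstar : 0 < pstar := hp.trans hppstar
  set K := (lqNormSeq q (fun k => ENNReal.ofReal (decayRate s ^ k.natAbs))).toReal
  have hK0 : 0 ≤ K := ENNReal.toReal_nonneg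
  have hK : lqNormSeq q (fun k => ENNReal.ofReal (decayRate s ^ k.natAbs)) ≤ ENNReal.ofReal K :=
    (ENNReal.ofReal_toReal
      (lqNormSeq_geometric_lt_top hq (decayRate_pos s) (decayRate_lt_one hs hs1)).ne).ge
  set θ := p / pstar with hθdef
  have hθ0 : 0 ≤ θ := by positivity
  have hθ1 : θ < 1 := (div_lt_one hpstar).2 hppstar
  have h1θ : 0 < 1 - θ := sub_pos.2 hθ1
  have hQθ : Q = s * p / (1 - θ) := by
    have hpos : 0 < s / Q := hQ ▸ sub_pos.2 (one_div_lt_one_div_of_lt hp hppstar)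
    have hQ0 : Q ≠ 0 := by
      rintro rfl
      simp at hpos
    rw [eq_div_iff h1θ.ne', hθdef]
    field_simp at hQ ⊢
    linarith
  set D := Real.log (Ce * (1 + 2 * K)) + s * Real.log 8 with hD
  set β := s * p * Real.log 2 with hβ
  refine ⟨Real.exp ((-(p * D) - θ * (β / (1 - θ))) / (1 - θ)), Real.exp_pos _, ?_⟩
  intro X _ _ _ μ hμ _ hemb x r hr hr1
  have hfin : ∀ (y : X) (t : ℝ), μ (ball y t) < ⊤ := fun y t => hμ.2 _ isBounded_ball
  have hpos : ∀ t : ℝ, 0 < t → 0 < μ.real (ball x t) := fun t ht =>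
    ENNReal.toReal_pos (hμ.1 _ isOpen_ball (nonempty_ball.2 ht)).ne' (hfin x t).ne
  obtain ⟨M, hM, hM'⟩ := exists_nat_pow_near ((one_le_inv₀ hr).2 hr1) one_lt_two
  set R : ℕ → ℝ := fun j => r * (1 / 2 + (1 / 2) ^ (j + 1)) with hR
  have hRhalf : ∀ j, r / 2 ≤ R j := fun j => by
    have : 0 ≤ r * (1 / 2) ^ (j + 1) := by positivity
    simp only [hR]
    linarith
  have hRpos : ∀ j, 0 < R j := fun j => (half_pos hr).trans_le (hRhalf j)
  have hrec : ∀ j : ℕ, (-(p * D) + s * p * Real.log r) - β * j +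
      θ * Real.log (μ.real (ball x (R (j + 1)))) ≤ Real.log (μ.real (ball x (R j))) := fun j => by
    have hgap : 1 ≤ 2 ^ (j + 3 + M) * (R j - R (j + 1)) := by
      have hM1 : 1 ≤ 2 ^ (M + 1) * r := by
        rw [← inv_mul_cancel₀ hr.ne']
        gcongr
      have hcancel : (2 : ℝ) ^ j * (1 / 2) ^ j = 1 := by
        rw [← mul_pow]
        norm_num
      refine hM1.trans_eq ?_
      simp only [hR, pow_add]
      linear_combination (-2 * 2 ^ M * r) * hcancel
    have hball := measure_ball_rpow_le_of_embedding μ hs hs1 hp hq hpstar hK hfin hCe hK0 hemb x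
      hgap
    have hscale : ((2 : ℝ) ^ (j + 3 + M)) ^ s ≤ (8 * 2 ^ j * r⁻¹) ^ s := by
      gcongr
      calc (2 : ℝ) ^ (j + 3 + M) = 8 * 2 ^ j * 2 ^ M := by ring
        _ ≤ _ := by gcongr
    have hμj := hpos _ (hRpos j)
    have hμj1 := hpos _ (hRpos (j + 1))
    have hball' : μ.real (ball x (R (j + 1))) ^ (1 / pstar) ≤
        Ce * (1 + 2 * K) * (8 * 2 ^ j * r⁻¹) ^ s * μ.real (ball x (R j)) ^ (1 / p) :=
      hball.trans (by gcongr)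
    have hlog := Real.log_le_log (by positivity) hball'
    rw [Real.log_rpow hμj1, Real.log_mul (by positivity) (by positivity),
      Real.log_mul (x := Ce * (1 + 2 * K)) (by positivity) (by positivity), Real.log_rpow (by positivity),
      Real.log_rpow hμj, Real.log_mul (x := 8 * 2 ^ j) (by positivity) (by positivity),
      Real.log_mul (x := 8) (by positivity) (by positivity), Real.log_inv, Real.log_pow] at hlog
    have hlog' := mul_le_mul_of_nonneg_left hlog hp.le
    have hcancel : p * (1 / p * Real.log (μ.real (ball x (R j)))) =
        Real.log (μ.real (ball x (R j))) := by
      field_simp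
    rw [mul_add, hcancel] at hlog'
    have hleft : p * (1 / pstar * Real.log (μ.real (ball x (R (j + 1))))) =
        θ * Real.log (μ.real (ball x (R (j + 1)))) := by
      rw [hθdef]
      ring
    rw [hleft] at hlog'
    rw [hβ, hD]
    linarith
  have hlower : ∀ j, Real.log (μ.real (ball x (r / 2))) ≤ Real.log (μ.real (ball x (R j))) :=
    fun j => Real.log_le_log (hpos _ (half_pos hr))
      (measureReal_mono (ball_subset_ball (hRhalf j)) (hfin _ _).ne)
  have hβ0 : 0 ≤ β := by
    have := Real.log_nonneg one_le_two
    positivity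
  have hmain := le_of_recursive_lower_bound hβ0 hθ0 hθ1 hlower hrec
  have hR0 : R 0 = r := by
    simp only [hR]
    ring
  rw [hR0] at hmain
  refine ENNReal.ofReal_le_of_le_toReal ?_
  change _ ≤ μ.real (ball x r)
  rw [← Real.exp_log (hpos r hr), Real.rpow_def_of_pos hr, ← Real.exp_add, Real.exp_le_exp]
  refine le_trans (le_of_eq ?_) hmain
  rw [hQθ]
  ring
end

section
/- Let (X,d,μ) be a geodesic metric measure space that is Q-doubling for some Q > 0. Then every sphere has measure zero: for every x ∈ X and every R > 0, μ(∂B(x,R)) = 0, where ∂B(x,R) = {y ∈ X : d(x,y) = R} is the boundary of the open ball B(x,R). -/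
open MeasureTheory Metric Set ENNReal Filter

/-- A metric space carrying an s-finite Borel measure which is positive on nonempty open sets is
second countable. -/
theorem secondCountableTopology_of_measure_pos {X : Type*} [MetricSpace X] [MeasurableSpace X]
    [BorelSpace X] (μ : MeasureTheory.Measure X) [SFinite μ]
    (hpos : ∀ U : Set X, IsOpen U → U.Nonempty → 0 < μ U) : SecondCountableTopology X := by
  refine Metric.secondCountable_of_almost_dense_set fun ε hε => ?_
  obtain ⟨u, -, hdisj, hcov⟩ := Vitali.exists_disjoint_subfamily_covering_enlargement_closedBall
    (Set.univ : Set X) id (fun _ => ε / 5) (ε / 5) (fun _ _ => le_rfl) 5 (by norm_num)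
  have hball (a : X) : 0 < μ (closedBall a (ε / 5)) :=
    (hpos _ isOpen_ball ⟨a, mem_ball_self (by positivity)⟩).trans_le
      (measure_mono ball_subset_closedBall)
  refine ⟨u, ?_, fun x => ?_⟩
  · have h := Measure.countable_meas_pos_of_disjoint_iUnion (μ := μ)
      (As := fun a : u => closedBall (a : X) (ε / 5)) (fun _ => measurableSet_closedBall)
      (fun a b hab => hdisj a.2 b.2 (Subtype.coe_injective.ne hab))
    simp only [hball, Set.ofPred_true, Set.countable_univ_iff] at h
    exact Set.countable_coe_iff.mp h
  · obtain ⟨b, hb, hsub⟩ := hcov x (mem_univ x)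
    refine ⟨b, hb, ?_⟩
    have hx := hsub (mem_closedBall_self (by positivity))
    rw [mul_div_cancel₀ _ (by norm_num)] at hx
    exact hx

theorem IsMetricMeasureSpace.sigmaFinite {X : Type*} [MetricSpace X] [MeasurableSpace X]
    {μ : MeasureTheory.Measure X} (hX : IsMetricMeasureSpace μ) : SigmaFinite μ := by
  rcases isEmpty_or_nonempty X with _ | ⟨⟨x⟩⟩
  · rw [Measure.eq_zero_of_isEmpty μ]
    infer_instance
  · exact ⟨⟨⟨fun n : ℕ => ball x n, fun _ => trivial, fun _ => hX.2 _ isBounded_ball,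
      iUnion_ball_nat x⟩⟩⟩

theorem IsMetricMeasureSpace.isLocallyFiniteMeasure {X : Type*} [MetricSpace X]
    [MeasurableSpace X] {μ : MeasureTheory.Measure X} (hX : IsMetricMeasureSpace μ) :
    IsLocallyFiniteMeasure μ :=
  ⟨fun x => ⟨ball x 1, ball_mem_nhds x one_pos, hX.2 _ isBounded_ball⟩⟩

theorem IsDoublingWith.isUnifLocDoublingMeasure {X : Type*} [MetricSpace X] [MeasurableSpace X]
    {μ : MeasureTheory.Measure X} {Cd : ℝ} (h : IsDoublingWith μ Cd) :
    IsUnifLocDoublingMeasure μ := by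
  refine ⟨⟨Cd.toNNReal * Cd.toNNReal, ?_⟩⟩
  filter_upwards [self_mem_nhdsWithin] with ε hε x
  have hε : 0 < ε := hε
  calc μ (closedBall x (2 * ε)) ≤ μ (ball x (2 * (2 * ε))) :=
        measure_mono (closedBall_subset_ball (by linarith))
    _ ≤ ENNReal.ofReal Cd * μ (ball x (2 * ε)) := h.2 x _ (by positivity)
    _ ≤ ENNReal.ofReal Cd * (ENNReal.ofReal Cd * μ (ball x ε)) := by gcongr; exact h.2 x ε hε
    _ ≤ ENNReal.ofReal Cd * (ENNReal.ofReal Cd * μ (closedBall x ε)) := by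
        gcongr; exact ball_subset_closedBall
    _ = _ := by rw [← mul_assoc, ENNReal.coe_mul]; rfl

/-- In a geodesic space, next to a point `y` of a sphere there is a ball of radius `δ` that misses
the sphere and whose centre is within `2 * δ` of `y`. -/
theorem IsGeodesicSpace.exists_disjoint_closedBall {X : Type*} [MetricSpace X]
    (hgeo : IsGeodesicSpace X) {x y : X} {R δ : ℝ} (hy : y ∈ sphere x R) (hδ : 0 < δ)
    (hδR : 2 * δ ≤ R) : ∃ w, y ∈ closedBall w (2 * δ) ∧ Disjoint (sphere x R) (closedBall w δ) := by
  obtain ⟨γ, h0, h1, hγ⟩ := hgeo x y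
  rw [dist_comm, mem_sphere.1 hy] at h1 hγ
  have hw : R - 2 * δ ∈ Set.Icc 0 R := ⟨by linarith, by linarith⟩
  have hR : 0 ≤ R := by linarith
  refine ⟨γ (R - 2 * δ), ?_, Set.disjoint_left.2 fun z hz hzw => ?_⟩
  · rw [mem_closedBall, ← h1, hγ R ⟨hR, le_rfl⟩ _ hw, _root_.sub_sub_cancel,
      abs_of_pos (by positivity)]
  · have hxw := hγ _ hw 0 ⟨le_rfl, hR⟩
    rw [h0, sub_zero, abs_of_nonneg hw.1] at hxw
    have := dist_triangle z (γ (R - 2 * δ)) x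
    rw [mem_sphere] at hz
    rw [mem_closedBall] at hzw
    linarith

/-- In a geodesic `Q`-doubling metric measure space (`Q > 0`), every
sphere has measure zero. -/
theorem sphere_measure_zero {X : Type*} [MetricSpace X] [MeasurableSpace X] [BorelSpace X]
    (μ : MeasureTheory.Measure X) (hX : IsMetricMeasureSpace μ)
    (hgeo : IsGeodesicSpace X) (Q : ℝ) (hQ : 0 < Q)
    (hdoub : ∃ Cd : ℝ, IsQDoubling μ Cd Q) :
    ∀ (x : X) (R : ℝ), 0 < R → μ (sphere x R) = 0 := by
  obtain ⟨Cd, hCd, -⟩ := hdoub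
  intro x R hR
  have := hX.sigmaFinite
  have := hX.isLocallyFiniteMeasure
  have := hCd.isUnifLocDoublingMeasure
  have := secondCountableTopology_of_measure_pos μ hX.1
  have hfalse : ∀ᵐ _ ∂μ.restrict (sphere x R), False := by
    filter_upwards [IsUnifLocDoublingMeasure.ae_tendsto_measure_inter_div μ (sphere x R) 2,
      ae_restrict_mem isClosed_sphere.measurableSet] with y hdens hy
    have : Nonempty X := ⟨y⟩
    choose! w hyw hdisj using fun δ (hδ : 0 < δ ∧ 2 * δ ≤ R) =>
      hgeo.exists_disjoint_closedBall hy hδ.1 hδ.2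
    have hsmall : ∀ᶠ δ in nhdsWithin (0 : ℝ) (Ioi 0), 0 < δ ∧ 2 * δ ≤ R := by
      filter_upwards [Ioc_mem_nhdsGT (half_pos hR)] with δ hδ
      exact ⟨hδ.1, by linarith [hδ.2]⟩
    have hone := hdens w id tendsto_id (hsmall.mono hyw)
    have hzero : Tendsto (fun δ => μ (sphere x R ∩ closedBall (w δ) (id δ)) /
        μ (closedBall (w δ) (id δ))) (nhdsWithin (0 : ℝ) (Ioi 0)) (nhds 0) := by
      refine tendsto_const_nhds.congr' (hsmall.mono fun δ hδ => ?_)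
      simp [(hdisj δ hδ).inter_eq]
    exact one_ne_zero (tendsto_nhds_unique hone hzero)
  rwa [eventually_false_iff_eq_bot, ae_eq_bot, Measure.restrict_eq_zero] at hfalse
end

section
/- Let (X,d,μ) be a metric measure space with doubling measure μ, let Q, s, p > 0, let A > 0, let x ∈ X and let 0 < r ≤ 1. Suppose that for every 0 < δ ≤ r one has μ(B(x,δ)) ≥ A^{pQ/(Q+sp)} (δ/2)^{spQ/(Q+sp)} ( μ(B(x,δ/2)) )^{Q/(Q+sp)}. Then μ(B(x,r)) ≥ A^{Q/s} 2^{−Q(Q+sp)/(sp)} r^Q; in particular, the lower bound constant depends only on A, Q, s, p and not on the doubling constant of μ. -/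
open MeasureTheory Metric Set ENNReal Filter

/-- A real sequence that contracts backwards by a factor `θ < 1` and grows at most linearly
starts at a nonpositive value. -/
theorem nonpos_of_le_mul_succ_of_le_add_mul {e : ℕ → ℝ} {θ L : ℝ} (hθ0 : 0 ≤ θ) (hθ1 : θ < 1)
    (hstep : ∀ n, e n ≤ θ * e (n + 1)) (hgrowth : ∀ n : ℕ, e n ≤ e 0 + n * L) : e 0 ≤ 0 := by
  have hpow : ∀ n : ℕ, e 0 ≤ θ ^ n * e n := by
    intro n
    induction n with
    | zero => simp
    | succ n ih =>
      calc e 0 ≤ θ ^ n * e n := ih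
        _ ≤ θ ^ n * (θ * e (n + 1)) := by gcongr; exact hstep n
        _ = θ ^ (n + 1) * e (n + 1) := by ring
  have hlim : Tendsto (fun n : ℕ => θ ^ n * e 0 + (n * θ ^ n) * L) atTop (nhds 0) := by
    simpa using ((tendsto_pow_atTop_nhds_zero_of_lt_one hθ0 hθ1).mul_const (e 0)).add
      ((tendsto_self_mul_const_pow_of_lt_one hθ0 hθ1).mul_const L)
  refine ge_of_tendsto' hlim fun n => (hpow n).trans ?_
  calc θ ^ n * e n ≤ θ ^ n * (e 0 + n * L) := by gcongr; exact hgrowth n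
    _ = θ ^ n * e 0 + (n * θ ^ n) * L := by ring

/-- A doubling measure loses at most `log Cd` in logarithmic mass when the radius is halved. -/
theorem IsDoublingWith.log_real_ball_le {X : Type*} [MetricSpace X] [MeasurableSpace X]
    {μ : MeasureTheory.Measure X} {Cd : ℝ} (hX : IsMetricMeasureSpace μ)
    (h : IsDoublingWith μ Cd) (x : X) {δ : ℝ} (hδ : 0 < δ) :
    Real.log (μ.real (ball x δ)) ≤ Real.log Cd + Real.log (μ.real (ball x (δ / 2))) := by
  have hpos : ∀ t : ℝ, 0 < t → 0 < μ.real (ball x t) := fun t ht =>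
    ENNReal.toReal_pos (hX.1 _ isOpen_ball ⟨x, mem_ball_self ht⟩).ne' (hX.2 _ isBounded_ball).ne
  have hCd : 0 < Cd := one_pos.trans_le h.1
  rw [← Real.log_mul hCd.ne' (hpos _ (half_pos hδ)).ne']
  refine Real.log_le_log (hpos δ hδ) ?_
  have h2 := h.2 x (δ / 2) (half_pos hδ)
  rw [mul_div_cancel₀ δ two_ne_zero] at h2
  have := ENNReal.toReal_mono (mul_ne_top ofReal_ne_top (hX.2 _ isBounded_ball).ne) h2
  rwa [toReal_mul, toReal_ofReal hCd.le] at this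

/-- In a metric measure space with doubling measure, if for all
`0 < δ ≤ r ≤ 1` one has
`μ(B(x,δ)) ≥ A^{pQ/(Q+sp)} (δ/2)^{spQ/(Q+sp)} μ(B(x,δ/2))^{Q/(Q+sp)}`, then
`μ(B(x,r)) ≥ A^{Q/s} 2^{-Q(Q+sp)/(sp)} r^Q`; the constant depends only on `A, Q, s, p`
and not on the doubling constant. -/
theorem iteration_lower_mass_bound {X : Type*} [MetricSpace X] [MeasurableSpace X]
    [BorelSpace X] (μ : MeasureTheory.Measure X) (hX : IsMetricMeasureSpace μ)
    (hdoub : ∃ Cd : ℝ, IsDoublingWith μ Cd)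
    (Q s p A : ℝ) (hQ : 0 < Q) (hs : 0 < s) (hp : 0 < p) (hA : 0 < A)
    (x : X) (r : ℝ) (hr : 0 < r) (hr1 : r ≤ 1)
    (hiter : ∀ δ : ℝ, 0 < δ → δ ≤ r →
      ENNReal.ofReal (A ^ (p * Q / (Q + s * p)) * (δ / 2) ^ (s * p * Q / (Q + s * p))) *
          μ (ball x (δ / 2)) ^ (Q / (Q + s * p)) ≤ μ (ball x δ)) :
    ENNReal.ofReal (A ^ (Q / s) * 2 ^ (-(Q * (Q + s * p)) / (s * p)) * r ^ Q)
      ≤ μ (ball x r) := by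
  obtain ⟨Cd, hCd⟩ := hdoub
  have hfin : ∀ t : ℝ, μ (ball x t) ≠ ⊤ := fun t => (hX.2 _ isBounded_ball).ne
  have hpos : ∀ t : ℝ, 0 < t → 0 < μ.real (ball x t) := fun t ht =>
    ENNReal.toReal_pos (hX.1 _ isOpen_ball ⟨x, mem_ball_self ht⟩).ne' (hfin t)
  have hsp : 0 < s * p := mul_pos hs hp
  have hD : 0 < Q + s * p := add_pos hQ hsp
  set θ : ℝ := Q / (Q + s * p) with hθ
  have hθ0 : 0 < θ := div_pos hQ hD
  have hθ1 : θ < 1 := (div_lt_one hD).2 (by linarith)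
  have hlog : ∀ δ : ℝ, 0 < δ → δ ≤ r →
      p * Q / (Q + s * p) * Real.log A + s * p * Q / (Q + s * p) * Real.log (δ / 2)
        + θ * Real.log (μ.real (ball x (δ / 2))) ≤ Real.log (μ.real (ball x δ)) := by
    intro δ hδ hδr
    have hδ2 : 0 < δ / 2 := half_pos hδ
    have h := ENNReal.toReal_mono (hfin δ) (hiter δ hδ hδr)
    rw [toReal_mul, toReal_ofReal (by positivity), ← toReal_rpow] at h
    change _ * μ.real (ball x (δ / 2)) ^ θ ≤ μ.real (ball x δ) at h
    have hm := hpos _ hδ2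
    have h' := Real.log_le_log (by positivity) h
    rwa [Real.log_mul (by positivity) (by positivity),
      Real.log_mul (by positivity) (by positivity), Real.log_rpow hA, Real.log_rpow hδ2,
      Real.log_rpow hm] at h'
  let g : ℝ → ℝ := fun δ =>
    Q / s * Real.log A + -(Q * (Q + s * p)) / (s * p) * Real.log 2 + Q * Real.log δ
  let e : ℕ → ℝ := fun n => g (r / 2 ^ n) - Real.log (μ.real (ball x (r / 2 ^ n)))
  have hrad : ∀ n : ℕ, r / 2 ^ (n + 1) = r / 2 ^ n / 2 := fun n => by
    rw [pow_succ, div_div]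
  have hg : ∀ δ : ℝ, 0 < δ → g δ = p * Q / (Q + s * p) * Real.log A
      + s * p * Q / (Q + s * p) * Real.log (δ / 2) + θ * g (δ / 2) := by
    intro δ hδ
    simp only [g, hθ, Real.log_div hδ.ne' two_ne_zero]
    field_simp
    ring
  have hstep : ∀ n, e n ≤ θ * e (n + 1) := by
    intro n
    have hδ : 0 < r / 2 ^ n := by positivity
    have h1 := hlog _ hδ (div_le_self hr.le (one_le_pow₀ one_le_two))
    have h2 := hg _ hδ
    simp only [e, hrad]
    linarith
  have hgrowth : ∀ n : ℕ, e n ≤ e 0 + n * Real.log Cd := by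
    intro n
    induction n with
    | zero => simp
    | succ n ih =>
      have hδ : 0 < r / 2 ^ n := by positivity
      have h1 := hCd.log_real_ball_le hX x hδ
      have h2 : g (r / 2 ^ n / 2) ≤ g (r / 2 ^ n) := by
        have := Real.log_le_log (half_pos hδ) (half_le_self hδ.le)
        exact add_le_add_right (mul_le_mul_of_nonneg_left this hQ.le) _
      have h3 : e (n + 1) ≤ e n + Real.log Cd := by
        simp only [e, hrad]
        linarith
      push_cast
      linarith
  have he := nonpos_of_le_mul_succ_of_le_add_mul hθ0.le hθ1 hstep hgrowth
  simp only [e, g, pow_zero, div_one] at he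
  refine ofReal_le_of_le_toReal ((Real.log_le_log_iff (by positivity) (hpos r hr)).1 ?_)
  rw [Real.log_mul (by positivity) (by positivity),
    Real.log_mul (by positivity) (by positivity), Real.log_rpow hA, Real.log_rpow two_pos,
    Real.log_rpow hr]
  linarith
end
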